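/- arXiv:2210.08776 — 3 statements merged into one kernel-verified Lean document; each statement's English description precedes it below -/
import Mathlib

section
/- Let n ≥ 2 and r ≥ 2 be integers, let R be a 2-torsion-free unital ring, and let M_r(R) be the full ring of r × r matrices over R. Then every multiplicative generalized Jordan n-derivation Δ : M_r(R) → M_r(R) can be expressed as Δ(t) = μt + δ(t) for all t ∈ M_r(R), where μ lies in the center Z(M_r(R)) and δ : M_r(R) → M_r(R) is a derivation. -/
/-- The Jordan `n`-product `qₙ(t₁,…,tₙ)`, folding the Jordan product `a∘b = ab + ba`
from the left: `q₁(t₁) = t₁`, `qₙ(t₁,…,tₙ) = qₙ₋₁(t₁,…,tₙ₋₁)∘tₙ`. -/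
def jordanProd {A : Type*} [Ring A] : List A → A
  | [] => 0
  | t :: ts => ts.foldl (fun x y => x * y + y * x) t

/-- A map `δ` (not assumed additive) is a multiplicative Jordan `n`-derivation if
`δ(qₙ(t₁,…,tₙ)) = Σᵢ qₙ(t₁,…,δ(tᵢ),…,tₙ)` for all `t₁,…,tₙ`. -/
def IsMulJordanDeriv {A : Type*} [Ring A] (n : ℕ) (δ : A → A) : Prop :=
  ∀ l : List A, l.length = n →
    δ (jordanProd l) = ∑ i ∈ Finset.range n, jordanProd (l.set i (δ (l.getD i 0)))

/-- A map `Δ` is a multiplicative generalized Jordan `n`-derivation (with associated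
multiplicative Jordan `n`-derivation `δ`). -/
def IsMulGenJordanDeriv {A : Type*} [Ring A] (n : ℕ) (Δ δ : A → A) : Prop :=
  ∀ l : List A, l.length = n →
    Δ (jordanProd l) = jordanProd (l.set 0 (Δ (l.getD 0 0)))
      + ∑ i ∈ Finset.Ico 1 n, jordanProd (l.set i (δ (l.getD i 0)))

/-- `e` is an idempotent whose corner `eA(1-e)` contains `v` with a one-sided inverse
`w ∈ (1-e)Ae`, and `eA(1-e)` has no nonzero right annihilator in `(1-e)A`. -/
structure IsPeirceFrame {A : Type*} [Ring A] (e v w : A) : Prop where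
  idem : e * e = e
  ev : e * v = v
  ve : v * e = 0
  ew : e * w = 0
  we : w * e = w
  vw : v * w = e
  faithful : ∀ b : A, (∀ x : A, e * x = x → x * e = 0 → x * b = 0) → (1 - e) * b = 0

/-- The off-diagonal Peirce projection `t ↦ et(1-e) + (1-e)te`. -/
def peirceOff {A : Type*} [Ring A] (e t : A) : A := e * t + t * e - (e * t * e + e * t * e)

theorem peirceOff_add {A : Type*} [Ring A] (e a b : A) :
    peirceOff e (a + b) = peirceOff e a + peirceOff e b := by
  simp only [peirceOff, mul_add, add_mul]
  abel

theorem peirceOff_smul {A : Type*} [Ring A] (e : A) (K : ℕ) (z : A) :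
    peirceOff e (K • z) = K • peirceOff e z := by
  simp only [peirceOff, mul_smul_comm, smul_mul_assoc, smul_add, smul_sub]

theorem peirceOff_jordan {A : Type*} [Ring A] {e x : A} (hx : e * x + x * e = x) (t : A) :
    peirceOff e (x * t + t * x) = x * (t - peirceOff e t) + (t - peirceOff e t) * x := by
  have k2 : x * e = x - e * x := by rw [eq_sub_iff_add_eq, add_comm]; exact hx
  have k3 : ∀ z, x * (e * z) = x * z - e * (x * z) := by
    intro z; rw [← mul_assoc, k2, sub_mul, mul_assoc]
  simp only [peirceOff, mul_add, add_mul, mul_sub, sub_mul, mul_assoc, k2, k3]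
  abel

namespace IsPeirceFrame

variable {A : Type*} [Ring A] {e v w : A}

theorem idem_mul (h : IsPeirceFrame e v w) (x : A) : e * (e * x) = e * x := by
  rw [← mul_assoc, h.idem]

theorem off_peirceOff (h : IsPeirceFrame e v w) (t : A) :
    e * peirceOff e t + peirceOff e t * e = peirceOff e t := by
  simp only [peirceOff, mul_add, add_mul, mul_sub, sub_mul, mul_assoc, h.idem, h.idem_mul]
  abel

theorem mul_mul_eq_zero_of_off (h : IsPeirceFrame e v w) {x : A} (hx : e * x + x * e = x) :
    e * (x * e) = 0 := by
  have h₁ := congrArg (e * ·) hx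
  simp only [mul_add, h.idem_mul] at h₁
  simpa using h₁

theorem peirceOff_of_off (h : IsPeirceFrame e v w) {x : A} (hx : e * x + x * e = x) :
    peirceOff e x = x := by
  rw [peirceOff, hx, mul_assoc, h.mul_mul_eq_zero_of_off hx, add_zero, sub_zero]

/-- The product of off-diagonal elements is diagonal. -/
theorem peirceOff_jordan_off (h : IsPeirceFrame e v w) {x y : A} (hx : e * x + x * e = x)
    (hy : e * y + y * e = y) : peirceOff e (x * y + y * x) = 0 := by
  rw [peirceOff_jordan hx, h.peirceOff_of_off hy, sub_self, mul_zero, zero_mul, add_zero]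

/-- An element commuting with both off-diagonal corners is central. -/
theorem central (h : IsPeirceFrame e v w) {c : A}
    (h₁ : ∀ x, e * x = x → x * e = 0 → c * x = x * c)
    (h₂ : ∀ x, e * x = 0 → x * e = x → c * x = x * c) (a : A) : c * a = a * c := by
  have hv := h₁ v h.ev h.ve
  have hw := h₂ w h.ew h.we
  have hvw : c * e = e * c := by
    rw [← h.vw, ← mul_assoc, hv, mul_assoc, hw, mul_assoc]
  have hI := h.idem_mul
  have hcorner : ∀ x, e * x = x → c * x = x * c := by
    intro x hx
    have k₁ : c * (x * e) = x * e * c := by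
      have l₁ := h₁ (x * e * v) (by rw [← mul_assoc, ← mul_assoc, hx]) (by
        rw [mul_assoc, h.ve, mul_zero])
      calc c * (x * e) = c * (x * e * v) * w := by
            rw [mul_assoc, mul_assoc (x * e), h.vw, mul_assoc x, h.idem]
        _ = x * e * v * (c * w) := by rw [l₁, mul_assoc]
        _ = x * e * (v * w) * c := by rw [hw]; simp only [mul_assoc]
        _ = x * e * c := by rw [h.vw, mul_assoc x, h.idem]
    have k₂ := h₁ (x - x * e) (by rw [mul_sub, ← mul_assoc, hx]) (by
      rw [sub_mul, mul_assoc, h.idem, sub_self])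
    rw [mul_sub, sub_mul, k₁] at k₂
    exact sub_left_inj.mp k₂
  have hz : (1 - e) * (c * a - a * c) = 0 := by
    apply h.faithful
    intro x hx _
    have l₁ := hcorner x hx
    have l₂ := hcorner (x * a) (by rw [← mul_assoc, hx])
    rw [mul_sub, ← mul_assoc, ← l₁, mul_assoc, l₂, mul_assoc, sub_self]
  have hy : e * (c * a - a * c) = 0 := by
    have l := hcorner (e * a) (hI a)
    rw [mul_sub, ← mul_assoc, ← hvw, mul_assoc, l, mul_assoc, sub_self]
  rw [sub_mul, one_mul, hy, sub_zero, sub_eq_zero] at hz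
  exact hz

/-- An element commuting with every idempotent is central. -/
theorem central_of_idempotents (h : IsPeirceFrame e v w) {c : A}
    (hc : ∀ g, g * g = g → c * g = g * c) (a : A) : c * a = a * c := by
  have hce := hc e h.idem
  refine h.central (fun x hx hx' => ?_) (fun x hx hx' => ?_) a
  · have hxx : x * x = 0 := by rw [← hx, ← mul_assoc, mul_assoc e x e, hx', mul_zero, zero_mul]
    have := hc (e + x) (by
      rw [add_mul, mul_add, mul_add, h.idem, hx, hx', hxx]; abel)
    rw [mul_add, add_mul, hce] at this
    exact add_left_cancel this
  · have hxx : x * x = 0 := by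
      nth_rw 1 [← hx']
      rw [mul_assoc, hx, mul_zero]
    have := hc (e + x) (by
      rw [add_mul, mul_add, mul_add, h.idem, hx, hx', hxx]; abel)
    rw [mul_add, add_mul, hce] at this
    exact add_left_cancel this

theorem eq_zero_of_corner (h : IsPeirceFrame e v w) {z : A} (hl : e * z = z) (hr : z * e = z)
    (hz : ∀ x, e * x + x * e = x → x * z + z * x = 0) : z = 0 := by
  have k := hz v (by rw [h.ev, h.ve, add_zero])
  have k₁ : v * z = 0 := by rw [← hl, ← mul_assoc, h.ve, zero_mul]
  rw [k₁, zero_add] at k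
  rw [← hr, ← h.vw, ← mul_assoc, k, zero_mul]

theorem eq_zero_of_cocorner (h : IsPeirceFrame e v w) {z : A} (hl : e * z = 0) (hr : z * e = 0)
    (hz : ∀ x, e * x + x * e = x → x * z + z * x = 0) : z = 0 := by
  have k : (1 - e) * z = 0 := by
    apply h.faithful
    intro x hx hx'
    have k := hz x (by rw [hx, hx', add_zero])
    have k₁ : z * x = 0 := by rw [← hx, ← mul_assoc, hr, zero_mul]
    rwa [k₁, add_zero] at k
  rwa [sub_mul, one_mul, hl, sub_zero] at k

/-- On a ring with a Peirce frame, an additive Jordan derivation commuting with left and right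
multiplication by `e` is a derivation. -/
theorem derivation_of_jordan (h : IsPeirceFrame e v w) {δ : A → A}
    (hadd : ∀ x y, δ (x + y) = δ x + δ y)
    (hJ : ∀ x y, δ (x * y + y * x) = δ x * y + y * δ x + (x * δ y + δ y * x))
    (hl : ∀ x, δ (e * x) = e * δ x) (hr : ∀ x, δ (x * e) = δ x * e) (x y : A) :
    δ (x * y) = δ x * y + x * δ y := by
  obtain ⟨D, hD⟩ : ∃ D : A → A → A, ∀ x y, D x y = δ (x * y) - δ x * y - x * δ y :=
    ⟨_, fun _ _ => rfl⟩
  have hδ0 : δ 0 = 0 := by simpa using hadd 0 0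
  have hanti : ∀ x y, D x y = - D y x := by
    intro x y
    have := hJ x y
    rw [hadd, ← sub_eq_zero] at this
    rw [← sub_eq_zero, hD, hD, ← this]
    abel
  have hD0 : ∀ y, D 0 y = 0 := by intro y; simp [hD, hδ0]
  have hDadd : ∀ a b y, D (a + b) y = D a y + D b y := by
    intro a b y
    simp only [hD, add_mul, hadd]
    abel
  have hDl : ∀ x y, D (e * x) y = e * D x y := by
    intro x y
    simp only [hD, hl, mul_sub, mul_assoc]
  have hDm : ∀ x y, D (x * e) y = D x (e * y) := by
    intro x y
    simp only [hD, hr, hl, mul_assoc]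
  have hcoc : ∀ p q z, D (p * q) z = D p (q * z) + p * D q z - D p q * z := by
    intro p q z
    simp only [hD, mul_sub, sub_mul, mul_assoc]
    abel
  have hswap : ∀ x y, D (e * x) y = D (x * e) y := by
    intro x y
    rw [hDl, hanti, mul_neg, ← hDl, hanti, neg_neg, hDm]
  have h10 : ∀ x y, x * e = 0 → e * x = x → D x y = 0 := by
    intro x y hx hx'
    rw [← hx', hswap, hx, hD0]
  have h01 : ∀ x y, e * x = 0 → x * e = x → D x y = 0 := by
    intro x y hx hx'
    rw [← hx', ← hswap, hx, hD0]
  have h11 : ∀ x y, e * x = x → x * e = x → D x y = 0 := by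
    intro x y hx hx'
    have hp : ∀ z, D (x * v) z = 0 := fun z =>
      h10 _ z (by rw [mul_assoc, h.ve, mul_zero]) (by rw [← mul_assoc, hx])
    have := hcoc (x * v) w y
    rw [hp, hp, h01 w y h.ew h.we, mul_assoc, h.vw, hx'] at this
    simpa using this
  have h00 : ∀ x y, e * x = 0 → x * e = 0 → D x y = 0 := by
    intro x y hx hx'
    have k : (1 - e) * D x y = 0 := by
      apply h.faithful
      intro u hu hu'
      have := hcoc u x y
      rw [h10 u _ hu' hu, h10 u _ hu' hu,
        h10 (u * x) y (by rw [mul_assoc, hx', mul_zero]) (by rw [← mul_assoc, hu])] at this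
      simpa using this.symm
    rwa [sub_mul, one_mul, ← hDl, hx, hD0, sub_zero] at k
  have hdec : x = e * x * e + (e * x - e * x * e) + (x * e - e * x * e)
      + (x - e * x - x * e + e * x * e) := by abel
  have hDx : D x y = 0 := by
    rw [hdec, hDadd, hDadd, hDadd, h11, h10, h01, h00]
    · simp
    all_goals
      simp only [mul_add, add_mul, mul_sub, sub_mul, mul_assoc, h.idem, h.idem_mul]
      try abel
  rw [hD, sub_sub, sub_eq_zero] at hDx
  exact hDx

end IsPeirceFrame

/-- `δ` satisfies the Jordan derivation identity after scaling by the regular integer `K`, and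
vanishes at `1` and at `e`. -/
structure IsScaledJordan {A : Type*} [Ring A] (e : A) (K : ℕ) (δ : A → A) : Prop where
  two_regular : ∀ x : A, x + x = 0 → x = 0
  regular : ∀ x : A, K • x = 0 → x = 0
  map_one : δ 1 = 0
  map_idem : δ e = 0
  map_jordan : ∀ t s, δ (K • (t * s + s * t)) =
    K • (δ t * s + s * δ t + (t * δ s + δ s * t))

namespace IsScaledJordan

variable {A : Type*} [Ring A] {e v w : A} {K : ℕ} {δ : A → A}

theorem cancel (D : IsScaledJordan e K δ) {x y : A} (hxy : K • x = K • y) : x = y := by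
  rw [← sub_eq_zero] at hxy ⊢
  rw [← smul_sub] at hxy
  exact D.regular _ hxy

theorem map_zero (D : IsScaledJordan e K δ) : δ 0 = 0 := by
  have := D.map_jordan 0 0
  simpa using this

theorem map_smul_add_self (D : IsScaledJordan e K δ) (t : A) :
    δ (K • (t + t)) = K • (δ t + δ t) := by
  have := D.map_jordan t 1
  simpa [D.map_one] using this

theorem map_smul_left (D : IsScaledJordan e K δ) (t : A) :
    δ (K • (e * t + t * e)) = K • (e * δ t + δ t * e) := by
  have := D.map_jordan e t
  simpa [D.map_idem] using this

theorem map_compl (D : IsScaledJordan e K δ) (h : IsPeirceFrame e v w) : δ (1 - e) = 0 := by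
  have h₁ : e * δ (1 - e) + δ (1 - e) * e = 0 := by
    have := D.map_smul_left (1 - e)
    simp only [mul_sub, sub_mul, h.idem, mul_one, one_mul, sub_self, add_zero, smul_zero,
      D.map_zero] at this
    exact D.regular _ this.symm
  have h₂ := D.map_jordan (1 - e) (1 - e)
  have h₃ : (1 - e) * (1 - e) = 1 - e := by
    simp only [mul_sub, sub_mul, h.idem, mul_one, one_mul]; abel
  rw [h₃, D.map_smul_add_self] at h₂
  replace h₂ := D.cancel h₂
  apply D.two_regular
  simp only [mul_sub, sub_mul, mul_one, one_mul] at h₂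
  generalize δ (1 - e) = y at *
  have h₄ : y + y - (y + y + (y + y) - (e * y + y * e) - (e * y + y * e)) = 0 := by
    rw [sub_eq_zero]
    refine h₂.trans ?_
    abel
  rw [h₁] at h₄
  rw [← neg_eq_zero, ← h₄]
  abel

theorem map_smul_compl (D : IsScaledJordan e K δ) (h : IsPeirceFrame e v w) (t : A) :
    δ (K • (t + t - (e * t + t * e))) = K • (δ t + δ t - (e * δ t + δ t * e)) := by
  have := D.map_jordan (1 - e) t
  rw [D.map_compl h] at this
  simp only [mul_sub, sub_mul, mul_one, one_mul, zero_mul, mul_zero, zero_add, add_zero] at this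
  convert this using 2 <;> abel_nf

/-- `δ` preserves the off-diagonal part. -/
theorem off (D : IsScaledJordan e K δ) (h : IsPeirceFrame e v w) {x : A}
    (hx : e * x + x * e = x) : e * δ x + δ x * e = δ x := by
  have h₁ := D.map_smul_left x
  have h₂ := D.map_smul_compl h x
  rw [hx] at h₁
  rw [hx, add_sub_cancel_right, h₁] at h₂
  have h₃ := D.cancel h₂
  rw [← sub_eq_zero]
  apply D.two_regular
  rw [← sub_eq_zero] at h₃
  rw [← h₃]
  abel

theorem map_smul_off (D : IsScaledJordan e K δ) (h : IsPeirceFrame e v w) {x : A}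
    (hx : e * x + x * e = x) : δ (K • x) = K • δ x := by
  have h₁ := D.map_smul_left x
  rwa [hx, D.off h hx] at h₁

theorem map_peirceOff (D : IsScaledJordan e K δ) (h : IsPeirceFrame e v w) (t : A) :
    δ (peirceOff e t) = peirceOff e (δ t) := by
  have hoff' : ∀ t, e * (t + t - (e * t + t * e)) + (t + t - (e * t + t * e)) * e
      = peirceOff e t := by
    intro t
    simp only [peirceOff, mul_add, add_mul, mul_sub, sub_mul, mul_assoc, h.idem, h.idem_mul]
    abel
  have h₁ := D.map_smul_left (K • (t + t - (e * t + t * e)))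
  rw [D.map_smul_compl h] at h₁
  simp only [mul_smul_comm, smul_mul_assoc, ← smul_add, hoff'] at h₁
  rw [D.map_smul_off h, D.map_smul_off h (h.off_peirceOff t)] at h₁
  · exact D.cancel (D.cancel h₁)
  · simp only [mul_smul_comm, smul_mul_assoc, ← smul_add, h.off_peirceOff t]

theorem map_off_mul_diag (D : IsScaledJordan e K δ) (h : IsPeirceFrame e v w) {x : A}
    (hx : e * x + x * e = x) (t : A) :
    δ (x * (t - peirceOff e t) + (t - peirceOff e t) * x) =
      δ x * (t - peirceOff e t) + (t - peirceOff e t) * δ x +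
      (x * (δ t - peirceOff e (δ t)) + (δ t - peirceOff e (δ t)) * x) := by
  have h₁ := congrArg (peirceOff e) (D.map_jordan x t)
  rw [← D.map_peirceOff h, peirceOff_smul, peirceOff_smul, D.map_smul_off h (h.off_peirceOff _),
    peirceOff_jordan hx, peirceOff_add e (δ x * t + _), peirceOff_jordan hx,
    peirceOff_jordan (D.off h hx)] at h₁
  exact D.cancel h₁

theorem corner (D : IsScaledJordan e K δ) (h : IsPeirceFrame e v w) {a : A}
    (hl : e * a = a) (hr : a * e = a) : e * δ a = δ a ∧ δ a * e = δ a := by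
  have h₁ := D.map_smul_compl h a
  rw [hl, hr, sub_self, smul_zero, D.map_zero] at h₁
  have h₂ := sub_eq_zero.mp (D.regular _ h₁.symm)
  have h₃ := congrArg (e * ·) h₂
  have h₄ := congrArg (· * e) h₂
  simp only [mul_add, add_mul, h.idem_mul, mul_assoc, h.idem] at h₃ h₄
  have h₅ : e * δ a = e * (δ a * e) := add_left_cancel h₃
  have h₆ : δ a * e = e * (δ a * e) := add_right_cancel h₄
  have h₇ : e * δ a = δ a := by
    have h₈ : e * δ a = δ a * e := by rw [h₅, ← h₆]
    rw [← sub_eq_zero]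
    apply D.two_regular
    linear_combination (norm := abel) h₈ - h₂
  exact ⟨h₇, h₆.trans (h₅.symm.trans h₇)⟩

theorem cocorner (D : IsScaledJordan e K δ) (h : IsPeirceFrame e v w) {a : A}
    (hl : e * a = 0) (hr : a * e = 0) : e * δ a = 0 ∧ δ a * e = 0 := by
  have h₁ := D.map_smul_left a
  rw [hl, hr, add_zero, smul_zero, D.map_zero] at h₁
  have h₂ := D.regular _ h₁.symm
  have h₃ := congrArg (e * · * e) h₂
  have h₄ := congrArg (e * ·) h₂
  simp only [mul_add, add_mul, h.idem_mul, mul_assoc, h.idem, mul_zero, zero_mul] at h₃ h₄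
  rw [D.two_regular _ h₃, add_zero] at h₄
  rw [h₄, zero_add] at h₂
  exact ⟨h₄, h₂⟩

/-- The projection onto the `e`-corner commutes with `δ`. -/
theorem map_corner (D : IsScaledJordan e K δ) (h : IsPeirceFrame e v w) (t : A) :
    δ (e * t * e) = e * δ t * e := by
  obtain ⟨hl, hr⟩ := D.corner h (a := e * t * e) (by simp only [← mul_assoc, h.idem])
    (by simp only [mul_assoc, h.idem])
  have hd : ∀ s, K • (e * s + s * e) - peirceOff e (K • (e * s + s * e)) =
      K • (e * s * e + e * s * e) := by
    intro s
    rw [peirceOff_smul, ← smul_sub]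
    congr 1
    simp only [peirceOff, mul_add, add_mul, mul_assoc, h.idem, h.idem_mul]
    abel
  have hd' : ∀ s, e * s = s → s * e = s → s - peirceOff e s = s := by
    intro s hs hs'
    simp only [peirceOff, hs, hs', sub_self, sub_zero]
  have hz : δ (e * t * e) - e * δ t * e = 0 := by
    apply h.eq_zero_of_corner
    · rw [mul_sub, hl]; simp only [← mul_assoc, h.idem]
    · rw [sub_mul, hr]; simp only [mul_assoc, h.idem]
    · intro x hx
      have h₁ := D.map_off_mul_diag h hx (K • (e * t + t * e))
      have h₂ := D.map_off_mul_diag h hx (K • (e * t * e + e * t * e))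
      rw [D.map_smul_left, hd, hd] at h₁
      rw [hd' (K • (e * t * e + e * t * e)) (by
          simp only [mul_smul_comm, mul_add, ← mul_assoc, h.idem]) (by
          simp only [smul_mul_assoc, add_mul, mul_assoc, h.idem]), h₁, D.map_smul_add_self,
        hd' (K • (δ (e * t * e) + δ (e * t * e))) (by
          simp only [mul_smul_comm, mul_add, hl]) (by
          simp only [smul_mul_assoc, add_mul, hr])] at h₂
      have h₃ := add_left_cancel h₂
      simp only [mul_smul_comm, smul_mul_assoc, ← smul_add] at h₃
      replace h₃ := D.cancel h₃
      apply D.two_regular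
      rw [← sub_eq_zero] at h₃
      rw [← neg_eq_zero, ← h₃]
      simp only [mul_add, add_mul, mul_sub, sub_mul]
      abel
  exact sub_eq_zero.mp hz

/-- The projection onto the `(1-e)`-corner commutes with `δ`. -/
theorem map_cocorner (D : IsScaledJordan e K δ) (h : IsPeirceFrame e v w) (t : A) :
    δ (t - e * t - t * e + e * t * e) = δ t - e * δ t - δ t * e + e * δ t * e := by
  obtain ⟨P, hP⟩ : ∃ P : A → A, ∀ s, P s = s - e * s - s * e + e * s * e := ⟨_, fun _ => rfl⟩
  have hPl : ∀ s, e * P s = 0 := by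
    intro s
    rw [hP]
    simp only [mul_add, mul_sub, mul_assoc, h.idem_mul]
    abel
  have hPr : ∀ s, P s * e = 0 := by
    intro s
    rw [hP]
    simp only [add_mul, sub_mul, mul_assoc, h.idem]
    abel
  rw [← hP, ← hP]
  obtain ⟨hl, hr⟩ := D.cocorner h (hPl t) (hPr t)
  have hd : ∀ s, K • (s + s - (e * s + s * e)) - peirceOff e (K • (s + s - (e * s + s * e))) =
      K • (P s + P s) := by
    intro s
    rw [peirceOff_smul, ← smul_sub, hP]
    congr 1
    simp only [peirceOff, mul_add, add_mul, mul_sub, sub_mul, mul_assoc, h.idem, h.idem_mul]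
    abel
  have hd' : ∀ s, e * s = 0 → s * e = 0 → s - peirceOff e s = s := by
    intro s hs hs'
    simp only [peirceOff, hs, hs', zero_mul, add_zero, sub_zero]
  have hz : δ (P t) - P (δ t) = 0 := by
    apply h.eq_zero_of_cocorner
    · rw [mul_sub, hl, hPl, sub_zero]
    · rw [sub_mul, hr, hPr, sub_zero]
    · intro x hx
      have h₁ := D.map_off_mul_diag h hx (K • (t + t - (e * t + t * e)))
      have h₂ := D.map_off_mul_diag h hx (K • (P t + P t))
      rw [D.map_smul_compl h, hd, hd] at h₁
      rw [hd' (K • (P t + P t)) (by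
          simp only [mul_smul_comm, mul_add, hPl, add_zero, smul_zero]) (by
          simp only [smul_mul_assoc, add_mul, hPr, add_zero, smul_zero]), h₁,
        D.map_smul_add_self,
        hd' (K • (δ (P t) + δ (P t))) (by
          simp only [mul_smul_comm, mul_add, hl, add_zero, smul_zero]) (by
          simp only [smul_mul_assoc, add_mul, hr, add_zero, smul_zero])] at h₂
      have h₃ := add_left_cancel h₂
      simp only [mul_smul_comm, smul_mul_assoc, ← smul_add] at h₃
      replace h₃ := D.cancel h₃
      apply D.two_regular
      rw [← sub_eq_zero] at h₃
      rw [← neg_eq_zero, ← h₃]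
      simp only [mul_add, add_mul, mul_sub, sub_mul]
      abel
  exact sub_eq_zero.mp hz

theorem map_eq_peirce (D : IsScaledJordan e K δ) (h : IsPeirceFrame e v w) (t : A) :
    δ t = δ (peirceOff e t) + δ (e * t * e) + δ (t - e * t - t * e + e * t * e) := by
  rw [D.map_cocorner h, D.map_corner h, D.map_peirceOff h, peirceOff]
  abel

theorem map_off_add (D : IsScaledJordan e K δ) (h : IsPeirceFrame e v w) {x y : A}
    (hx : e * x + x * e = x) (hy : e * y + y * e = y) : δ (x + y) = δ x + δ y := by
  have hoe : peirceOff e e = 0 := by simp [peirceOff, h.idem]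
  have hof : peirceOff e (1 - e) = 0 := by simp [peirceOff, h.idem, mul_sub, sub_mul]
  have hxe : δ (e + x) = δ x := by
    rw [D.map_eq_peirce h]
    have k₁ : e * (e + x) * e = e := by
      rw [mul_add, add_mul, mul_assoc e x, h.mul_mul_eq_zero_of_off hx, h.idem, h.idem, add_zero]
    have k₂ : e + x - e * (e + x) - (e + x) * e + e * (e + x) * e = 0 := by
      rw [k₁, mul_add, add_mul, h.idem, ← sub_eq_zero.mpr hx.symm]
      abel
    rw [k₂, k₁, D.map_idem, D.map_zero, peirceOff_add, hoe, h.peirceOff_of_off hx]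
    simp
  have hyf : δ (1 - e + y) = δ y := by
    rw [D.map_eq_peirce h]
    have k₁ : e * (1 - e + y) * e = 0 := by
      rw [mul_add, add_mul, mul_assoc e y, h.mul_mul_eq_zero_of_off hy, mul_sub, sub_mul, mul_one,
        h.idem, h.idem, sub_self, add_zero]
    have k₂ : 1 - e + y - e * (1 - e + y) - (1 - e + y) * e + e * (1 - e + y) * e = 1 - e := by
      rw [k₁, mul_add, add_mul, mul_sub, sub_mul, mul_one, one_mul, h.idem, sub_self]
      nth_rw 1 [← hy]
      abel
    rw [k₂, k₁, D.map_compl h, D.map_zero, peirceOff_add, hof, h.peirceOff_of_off hy]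
    simp
  have key : ∀ a b, e * a + a * e = a → e * b + b * e = b →
      peirceOff e ((e + a) * (1 - e + b) + (1 - e + b) * (e + a)) = a + b := by
    intro a b ha hb
    have k : (e + a) * (1 - e + b) + (1 - e + b) * (e + a) = a + b + (a * b + b * a) := by
      simp only [mul_add, add_mul, mul_sub, sub_mul, mul_one, one_mul, h.idem]
      linear_combination (norm := abel) hb - ha
    rw [k, peirceOff_add, h.peirceOff_jordan_off ha hb, peirceOff_add, h.peirceOff_of_off ha,
      h.peirceOff_of_off hb, add_zero]
  have hdx := D.off h hx
  have hdy := D.off h hy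
  have h₁ := congrArg (peirceOff e) (D.map_jordan (e + x) (1 - e + y))
  rw [← D.map_peirceOff h, peirceOff_smul, key x y hx hy, D.map_smul_off h (by
    rw [mul_add, add_mul, add_add_add_comm, hx, hy]), hxe, hyf, peirceOff_smul] at h₁
  rw [D.cancel h₁]
  have k : δ x * (1 - e + y) + (1 - e + y) * δ x + ((e + x) * δ y + δ y * (e + x)) =
      δ x + δ y + (δ x * y + y * δ x) + (x * δ y + δ y * x) := by
    simp only [mul_add, add_mul, mul_sub, sub_mul, mul_one, one_mul]
    linear_combination (norm := abel) hdy - hdx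
  rw [k, peirceOff_add, peirceOff_add, peirceOff_add, h.peirceOff_jordan_off hdx hy,
    h.peirceOff_jordan_off hx hdy, h.peirceOff_of_off hdx, h.peirceOff_of_off hdy, add_zero,
    add_zero]

theorem map_corner_add (D : IsScaledJordan e K δ) (h : IsPeirceFrame e v w) {a b x : A}
    (ha : peirceOff e a = 0) (hb : peirceOff e b = 0) (hx : e * x + x * e = x) :
    x * (δ (a + b) - δ a - δ b) + (δ (a + b) - δ a - δ b) * x = 0 := by
  have hδ : ∀ c, peirceOff e c = 0 → δ (x * c + c * x) = δ x * c + c * δ x + (x * δ c + δ c * x) ∧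
      e * (x * c + c * x) + (x * c + c * x) * e = x * c + c * x := by
    intro c hc
    have h₁ := D.map_off_mul_diag h hx c
    rw [← D.map_peirceOff h, hc, D.map_zero, sub_zero, sub_zero] at h₁
    refine ⟨h₁, ?_⟩
    have h₂ := peirceOff_jordan hx c
    rw [hc, sub_zero] at h₂
    rw [← h₂]
    exact h.off_peirceOff _
  obtain ⟨k₁, l₁⟩ := hδ a ha
  obtain ⟨k₂, l₂⟩ := hδ b hb
  obtain ⟨k₃, -⟩ := hδ (a + b) (by rw [peirceOff_add, ha, hb, add_zero])
  have k₄ := D.map_off_add h l₁ l₂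
  rw [k₁, k₂, show x * a + a * x + (x * b + b * x) = x * (a + b) + (a + b) * x by
    simp only [mul_add, add_mul]; abel, k₃] at k₄
  simp only [mul_add, add_mul, mul_sub, sub_mul] at k₄ ⊢
  linear_combination (norm := abel) k₄

theorem map_add (D : IsScaledJordan e K δ) (h : IsPeirceFrame e v w) (s t : A) :
    δ (s + t) = δ s + δ t := by
  have h₁ : δ (e * (s + t) * e) = δ (e * s * e) + δ (e * t * e) := by
    have hl : ∀ t, e * (e * t * e) = e * t * e := fun t => by simp only [← mul_assoc, h.idem]
    have hr : ∀ t, e * t * e * e = e * t * e := fun t => by simp only [mul_assoc, h.idem]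
    have ho : ∀ t, peirceOff e (e * t * e) = 0 := fun t => by
      rw [peirceOff, hl, hr]; abel
    rw [← sub_eq_zero, ← sub_sub]
    have e₁ : e * (s + t) * e = e * s * e + e * t * e := by rw [mul_add, add_mul]
    refine h.eq_zero_of_corner ?_ ?_ fun x hx => ?_
    · simp only [D.map_corner h, mul_sub, hl]
    · simp only [D.map_corner h, sub_mul, hr]
    · rw [e₁]
      exact D.map_corner_add h (ho s) (ho t) hx
  have h₂ : δ (s + t - e * (s + t) - (s + t) * e + e * (s + t) * e) =
      δ (s - e * s - s * e + e * s * e) + δ (t - e * t - t * e + e * t * e) := by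
    have hl : ∀ t, e * (t - e * t - t * e + e * t * e) = 0 := fun t => by
      simp only [mul_add, mul_sub, mul_assoc, h.idem_mul]; abel
    have hr : ∀ t, (t - e * t - t * e + e * t * e) * e = 0 := fun t => by
      simp only [add_mul, sub_mul, mul_assoc, h.idem]; abel
    have ho : ∀ t, peirceOff e (t - e * t - t * e + e * t * e) = 0 := fun t => by
      rw [peirceOff, hl, hr, zero_mul]; abel
    rw [← sub_eq_zero, ← sub_sub]
    have e₁ : s + t - e * (s + t) - (s + t) * e + e * (s + t) * e =
        s - e * s - s * e + e * s * e + (t - e * t - t * e + e * t * e) := by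
      simp only [mul_add, add_mul]; abel
    refine h.eq_zero_of_cocorner ?_ ?_ fun x hx => ?_
    · simp only [D.map_cocorner h, mul_sub _ (_ - _), mul_sub _ (δ _ - _ - _ + _), hl, sub_zero]
    · simp only [D.map_cocorner h, sub_mul (_ - _), sub_mul (δ _ - _ - _ + _), hr, sub_zero]
    · rw [e₁]
      exact D.map_corner_add h (ho s) (ho t) hx
  have h₃ : δ (peirceOff e (s + t)) = δ (peirceOff e s) + δ (peirceOff e t) := by
    rw [peirceOff_add, D.map_off_add h (h.off_peirceOff s) (h.off_peirceOff t)]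
  rw [D.map_eq_peirce h (s + t), D.map_eq_peirce h s, D.map_eq_peirce h t, h₁, h₂, h₃]
  abel

theorem jordan (D : IsScaledJordan e K δ) (h : IsPeirceFrame e v w) (t s : A) :
    δ (t * s + s * t) = δ t * s + s * δ t + (t * δ s + δ s * t) := by
  have h₁ := D.map_jordan t s
  have h₂ : ∀ x, δ (K • x) = K • δ x := fun x =>
    map_nsmul (AddMonoidHom.mk' δ (D.map_add h)) K x
  rw [h₂] at h₁
  exact D.cancel h₁

/-- `δ` preserves `eA(1-e)`. -/
theorem upper (D : IsScaledJordan e K δ) (h : IsPeirceFrame e v w) {x : A}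
    (hx : e * x = x) (hx' : x * e = 0) : δ x * e = 0 := by
  have hv : δ v * e = 0 := by
    have h₁ := D.jordan h v v
    have hvv : v * v = 0 := by
      nth_rw 2 [← h.ev]
      rw [← mul_assoc, h.ve, zero_mul]
    have hδ := D.off h (x := v) (by rw [h.ev, h.ve, add_zero])
    rw [hvv, add_zero, D.map_zero] at h₁
    have h₂ : v * δ v + δ v * v = 0 := by
      rw [← D.two_regular (v * δ v + δ v * v)]
      linear_combination (norm := abel) - h₁
    have h₃ : e * δ v * e = 0 := by rw [mul_assoc, h.mul_mul_eq_zero_of_off hδ]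
    have h₄ : δ v * v = 0 := by
      have := congrArg (e * ·) h₂
      simp only [mul_add, mul_zero] at this
      have h₅ : e * (δ v * v) = 0 := by
        calc e * (δ v * v) = e * (δ v * (e * v)) := by rw [h.ev]
          _ = e * δ v * e * v := by simp only [mul_assoc]
          _ = 0 := by rw [h₃, zero_mul]
      rw [← mul_assoc, h.ev, h₅, add_zero] at this
      rwa [this, zero_add] at h₂
    rw [← h.vw, ← mul_assoc, h₄, zero_mul]
  have k := D.jordan h v (w * x)
  have k₁ : v * (w * x) + w * x * v = x := by
    have k₂ : x * v = 0 := by rw [← h.ev, ← mul_assoc, hx', zero_mul]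
    rw [← mul_assoc, h.vw, hx, mul_assoc, k₂, mul_zero, add_zero]
  obtain ⟨hb, hb'⟩ := D.cocorner h (a := w * x) (by rw [← mul_assoc, h.ew, zero_mul])
    (by rw [mul_assoc, hx', mul_zero])
  rw [k₁] at k
  rw [k]
  simp only [add_mul, mul_assoc, hx', hv, hb', h.ve, mul_zero, add_zero]

/-- `δ` preserves `(1-e)Ae`. -/
theorem lower (D : IsScaledJordan e K δ) (h : IsPeirceFrame e v w) {x : A}
    (hx : e * x = 0) (hx' : x * e = x) : e * δ x = 0 := by
  have hw : e * δ w = 0 := by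
    have h₁ := D.jordan h w w
    have hww : w * w = 0 := by
      nth_rw 1 [← h.we]
      rw [mul_assoc, h.ew, mul_zero]
    have hδ := D.off h (x := w) (by rw [h.ew, h.we, zero_add])
    rw [hww, add_zero, D.map_zero] at h₁
    have h₂ : w * δ w + δ w * w = 0 := by
      rw [← D.two_regular (w * δ w + δ w * w)]
      linear_combination (norm := abel) - h₁
    have h₃ : e * (δ w * e) = 0 := h.mul_mul_eq_zero_of_off hδ
    have h₄ : w * δ w = 0 := by
      have h₅ := congrArg (· * e) h₂
      have h₆ : w * δ w * e = 0 := by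
        calc w * δ w * e = w * e * δ w * e := by rw [h.we]
          _ = w * (e * (δ w * e)) := by simp only [mul_assoc]
          _ = 0 := by rw [h₃, mul_zero]
      simp only [add_mul, zero_mul] at h₅
      rw [h₆, zero_add, mul_assoc, h.we] at h₅
      rwa [h₅, add_zero] at h₂
    rw [← h.vw, mul_assoc, h₄, mul_zero]
  have k := D.jordan h (x * v) w
  have k₁ : x * v * w + w * (x * v) = x := by
    have k₂ : w * x = 0 := by rw [← h.we, mul_assoc, hx, mul_zero]
    rw [mul_assoc, h.vw, hx', ← mul_assoc, k₂, zero_mul, add_zero]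
  obtain ⟨hb, hb'⟩ := D.cocorner h (a := x * v) (by rw [← mul_assoc, hx, zero_mul])
    (by rw [mul_assoc, h.ve, mul_zero])
  rw [k₁] at k
  rw [k]
  simp only [mul_add, ← mul_assoc, hx, hw, hb, h.ew, zero_mul, add_zero]

theorem derivation (D : IsScaledJordan e K δ) (h : IsPeirceFrame e v w) (x y : A) :
    δ (x * y) = δ x * y + x * δ y := by
  have hl : ∀ t, δ (e * t) = e * δ t := by
    intro t
    have d₁ : e * t = e * t * e + (e * t - e * t * e) := by abel
    have d₂ : t = e * t * e + (e * t - e * t * e) + (t * e - e * t * e) +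
        (t - e * t - t * e + e * t * e) := by abel
    obtain ⟨k₁, -⟩ := D.corner h (a := e * t * e) (by simp only [← mul_assoc, h.idem])
      (by simp only [mul_assoc, h.idem])
    have l₂ : e * (e * t - e * t * e) = e * t - e * t * e := by
      simp only [mul_sub, ← mul_assoc, h.idem]
    have l₃ : (e * t - e * t * e) * e = 0 := by
      simp only [sub_mul, mul_assoc, h.idem, sub_self]
    have k₂ := D.off h (x := e * t - e * t * e) (by rw [l₂, l₃, add_zero])
    rw [D.upper h l₂ l₃, add_zero] at k₂
    have k₃ := D.lower h (x := t * e - e * t * e)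
      (by simp only [mul_sub, ← mul_assoc, h.idem, sub_self])
      (by simp only [sub_mul, mul_assoc, h.idem])
    obtain ⟨k₄, -⟩ := D.cocorner h (a := t - e * t - t * e + e * t * e)
      (by simp only [mul_add, mul_sub, ← mul_assoc, h.idem]; abel)
      (by simp only [add_mul, sub_mul, mul_assoc, h.idem]; abel)
    have r : δ t = δ (e * t * e) + δ (e * t - e * t * e) + δ (t * e - e * t * e) +
        δ (t - e * t - t * e + e * t * e) := by
      rw [← D.map_add h, ← D.map_add h, ← D.map_add h, ← d₂]
    rw [r, d₁, D.map_add h, ← d₁]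
    simp only [mul_add _ (δ _), mul_add _ (δ _ + _), mul_add _ (δ _ + _ + _), k₁, k₂, k₃, k₄,
      add_zero]
  refine h.derivation_of_jordan (D.map_add h) (D.jordan h) hl (fun t => ?_) x y
  have k := D.jordan h e t
  rw [D.map_add h, hl, D.map_idem, zero_mul, mul_zero, zero_add, zero_add] at k
  exact add_left_cancel k

end IsScaledJordan

namespace IsPeirceFrame

variable {A : Type*} [Ring A] {e v w : A} {K : ℕ}

/-- A map with `Φ(t∘s) = Φ(t)∘s` up to scaling is multiplication by a central element. -/
theorem exists_central_mul (h : IsPeirceFrame e v w) (h2 : ∀ x : A, x + x = 0 → x = 0)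
    (hK : ∀ x : A, K • x = 0 → x = 0) {Φ : A → A}
    (H : ∀ t s, Φ (K • (t * s + s * t)) = K • (Φ t * s + s * Φ t)) :
    ∃ c : A, (∀ a, c * a = a * c) ∧ ∀ t, Φ t = c * t := by
  have hcancel : ∀ {x y : A}, K • x = K • y → x = y := by
    intro x y hxy
    rw [← sub_eq_zero] at hxy ⊢
    rw [← smul_sub] at hxy
    exact hK _ hxy
  obtain ⟨c, hc⟩ : ∃ c, c = Φ 1 := ⟨_, rfl⟩
  have hsymm : ∀ t s, Φ t * s + s * Φ t = Φ s * t + t * Φ s := by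
    intro t s
    apply hcancel
    rw [← H, ← H, add_comm]
  have hΦ : ∀ t, Φ t + Φ t = c * t + t * c := by
    intro t
    have := hsymm t 1
    rwa [mul_one, one_mul, ← hc] at this
  have hcomm : ∀ t s, c * (t * s - s * t) = (t * s - s * t) * c := by
    intro t s
    have h₁ := hsymm t s
    have h₂ : (Φ t + Φ t) * s + s * (Φ t + Φ t) = (Φ s + Φ s) * t + t * (Φ s + Φ s) := by
      simp only [add_mul, mul_add]
      linear_combination (norm := abel) h₁ + h₁
    rw [hΦ, hΦ] at h₂
    simp only [add_mul, mul_add, mul_sub, sub_mul, mul_assoc] at h₂ ⊢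
    linear_combination (norm := abel) h₂
  have hcen : ∀ a, c * a = a * c := h.central
    (fun x hx hx' => by have := hcomm e x; rwa [hx, hx', sub_zero] at this)
    (fun x hx hx' => by have := hcomm x e; rwa [hx, hx', sub_zero] at this)
  refine ⟨c, hcen, fun t => ?_⟩
  rw [← sub_eq_zero]
  apply h2
  have := hΦ t
  rw [← hcen t] at this
  linear_combination (norm := abel) this

/-- A map satisfying the Jordan `(m + 2)`-derivation identity at tuples `(t, s, 1, …, 1)` is the
sum of a central multiplication and a derivation. -/
theorem exists_central_add_derivation (h : IsPeirceFrame e v w)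
    (h2 : ∀ x : A, x + x = 0 → x = 0) {m : ℕ} (hK : ∀ (j : ℕ) (x : A), 2 ^ j • x = 0 → x = 0)
    {δ : A → A}
    (H : ∀ t s, 2 • δ (2 ^ m • (t * s + s * t)) = 2 ^ m •
      (2 • (δ t * s + s * δ t + (t * δ s + δ s * t)) +
        m • ((t * s + s * t) * δ 1 + δ 1 * (t * s + s * t)))) :
    ∃ c : A, ∃ d : A → A, (∀ a, c * a = a * c) ∧ (∀ x y, d (x + y) = d x + d y) ∧
      (∀ x y, d (x * y) = d x * y + x * d y) ∧ ∀ t, δ t = c * t + d t := by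
  have hcancel : ∀ (j : ℕ) {x y : A}, 2 ^ j • x = 2 ^ j • y → x = y := by
    intro j x y hxy
    rw [← sub_eq_zero] at hxy ⊢
    rw [← smul_sub] at hxy
    exact hK j _ hxy
  have hcancel2 : ∀ {x y : A}, 2 • x = 2 • y → x = y := by
    intro x y hxy
    exact hcancel 1 (by simpa using hxy)
  obtain ⟨c, hc⟩ : ∃ c, c = δ 1 := ⟨_, rfl⟩
  rw [← hc] at H
  have hidem : ∀ g, g * g = g → δ g + δ g + (g * c + c * g) = 2 • (g * δ g + δ g * g) := by
    intro g hg
    have h₁ := H g 1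
    have h₂ := H g g
    rw [← hc, mul_one, one_mul, mul_one, one_mul] at h₁
    rw [hg, h₁] at h₂
    have h₃ := hcancel2 (add_right_cancel (hcancel m h₂))
    rw [h₃]
    abel
  have hcen : ∀ a, c * a = a * c := by
    apply h.central_of_idempotents
    intro g hg
    have h₁ := congrArg (g * ·) (hidem g hg)
    have h₂ := congrArg (· * g) (hidem g hg)
    have hg' : ∀ x, g * (g * x) = g * x := fun x => by rw [← mul_assoc, hg]
    simp only [mul_add, add_mul, mul_assoc, hg, hg', smul_add, mul_smul_comm, smul_mul_assoc]
      at h₁ h₂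
    linear_combination (norm := abel) h₂ - h₁
  have H' : ∀ t s, δ (2 ^ m • (t * s + s * t)) = 2 ^ m •
      (δ t * s + s * δ t + (t * δ s + δ s * t) + m • (c * (t * s + s * t))) := by
    intro t s
    apply hcancel2
    rw [H, ← hcen, smul_comm 2 (2 ^ m)]
    congr 1
    rw [smul_add 2 _ (m • _), smul_comm 2 m, two_smul ℕ (c * _)]
  obtain ⟨d, hd⟩ : ∃ d, d = (m + 1) • c := ⟨_, rfl⟩
  have hdcen : ∀ a, d * a = a * d := by
    intro a
    rw [hd, smul_mul_assoc, mul_smul_comm, hcen]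
  have hdouble : ∀ t, δ (2 ^ (m + 1) • t) = 2 ^ (m + 1) • (δ t + d * t) := by
    intro t
    have h₁ := H' t 1
    rw [← hc, mul_one, one_mul, mul_one, one_mul, ← hcen t] at h₁
    rw [pow_succ, mul_smul, two_smul ℕ t, h₁, mul_smul]
    congr 1
    rw [hd, add_smul, one_smul, add_mul, smul_mul_assoc, mul_add, smul_add m]
    abel
  obtain ⟨y, hy⟩ : ∃ y, y = δ e := ⟨_, rfl⟩
  have hye : y + c * e = e * y + y * e := by
    have := hidem e h.idem
    rw [← hy, ← hcen] at this
    apply hcancel2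
    rw [← this]
    abel
  have heye : e * (y * e) = c * e := by
    have := congrArg (e * ·) hye
    simp only [mul_add, h.idem_mul] at this
    rw [← mul_assoc e c, ← hcen e, mul_assoc, h.idem] at this
    exact (add_left_cancel this).symm
  obtain ⟨φ, hφ⟩ : ∃ φ : A → A, ∀ x, φ x = e * δ x - e * (δ x * e) := ⟨_, fun _ => rfl⟩
  have hφ₁ : ∀ x, e * x = x → x * e = 0 → φ (2 ^ m • x) = 2 ^ m • (φ x + d * x) := by
    intro x hx hx'
    have h₁ := H' x e
    rw [hx, hx', zero_add, ← hy] at h₁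
    have h₂ : x * y = x * (y * e) := by
      have := congrArg (x * ·) hye
      simp only [mul_add] at this
      rw [← mul_assoc x c, ← hcen x, mul_assoc, hx', mul_zero, add_zero, ← mul_assoc x e, hx',
        zero_mul, zero_add] at this
      exact this
    have h₃ : e * (y * x) = c * x := by
      calc e * (y * x) = e * (y * e) * x := by
            rw [mul_assoc, mul_assoc, hx]
        _ = c * x := by rw [heye, mul_assoc, hx]
    have h₄ : ∀ a : A, e * (c * a) = c * (e * a) := by
      intro a; rw [← mul_assoc, ← hcen, mul_assoc]
    rw [hφ, hφ, h₁, hd, smul_mul_assoc, mul_smul_comm, smul_mul_assoc, mul_smul_comm, ← smul_sub]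
    congr 1
    simp only [mul_add, add_mul, mul_assoc, h.idem_mul, h.idem, hx', mul_smul_comm,
      smul_mul_assoc, h₃, h₄, hx, mul_zero, smul_zero, add_smul, one_smul]
    rw [h₂]
    abel
  have hφ₂ : ∀ x, e * x = x → x * e = 0 → φ (2 ^ (m + 1) • x) = 2 ^ (m + 1) • (φ x + d * x) := by
    intro x hx hx'
    rw [hφ, hφ, hdouble, mul_smul_comm, smul_mul_assoc, mul_smul_comm, ← smul_sub]
    congr 1
    rw [add_mul, mul_assoc d, hx', mul_zero, add_zero, mul_add, ← mul_assoc e d, ← hdcen, mul_assoc,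
      hx]
    abel
  have hiter : ∀ N : ℕ, (∀ x, e * x = x → x * e = 0 → φ (N • x) = N • (φ x + d * x)) →
      ∀ j : ℕ, φ (N ^ j • v) = N ^ j • (φ v + j • (d * v)) := by
    intro N hN j
    induction j with
    | zero => simp
    | succ j ih =>
      rw [pow_succ', mul_smul, hN _ (by rw [mul_smul_comm, h.ev])
        (by rw [smul_mul_assoc, h.ve, smul_zero]), ih, mul_smul_comm, ← smul_add, mul_smul,
        add_smul, one_smul, add_assoc]
  have hdv : d * v = 0 := by
    have h₁ := hiter _ hφ₁ (m + 1)
    have h₂ := hiter _ hφ₂ m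
    rw [← pow_mul] at h₁ h₂
    rw [mul_comm (m + 1) m, h₁] at h₂
    have h₃ := add_left_cancel (hcancel _ h₂)
    rw [add_smul, one_smul] at h₃
    simpa using h₃
  have hde : d * e = 0 := by rw [← h.vw, ← mul_assoc, hdv, zero_mul]
  have hd0 : d = 0 := by
    have h₁ : (1 - e) * d = 0 := h.faithful d fun x hx _ => by
      rw [← hdcen, ← hx, ← mul_assoc, hde, zero_mul]
    rwa [sub_mul, ← hdcen e, hde, one_mul, sub_zero] at h₁
  have hmc : ∀ a, m • (c * a) = - (c * a) := by
    intro a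
    rw [eq_neg_iff_add_eq_zero, ← smul_mul_assoc, ← add_mul]
    have : m • c + c = 0 := by rw [← hd0, hd, add_smul, one_smul]
    rw [this, zero_mul]
  obtain ⟨p, hp⟩ : ∃ p, p = y * e - e * y := ⟨_, rfl⟩
  have D : IsScaledJordan e (2 ^ m) fun t => δ t - c * t - (p * t - t * p) := by
    refine ⟨h2, hK m, ?_, ?_, fun t s => ?_⟩
    · simp [← hc]
    · rw [hp, ← hy]
      simp only [mul_sub, sub_mul, mul_assoc, h.idem, h.idem_mul, heye]
      linear_combination (norm := abel) hye
    · rw [H', hmc, mul_smul_comm, mul_smul_comm, smul_mul_assoc, ← smul_sub, ← smul_sub, ← smul_sub]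
      congr 1
      have h₂ : ∀ a b, a * (c * b) = c * (a * b) := by
        intro a b; rw [← mul_assoc, ← hcen, mul_assoc]
      simp only [mul_add, add_mul, mul_sub, sub_mul, mul_assoc, h₂]
      abel
  refine ⟨c, fun t => δ t - c * t, hcen, fun x y => ?_, fun x y => ?_, fun t => (add_sub_cancel _ _).symm⟩
  · have := D.map_add h x y
    simp only [mul_add, add_mul] at this ⊢
    linear_combination (norm := abel) this
  · have := D.derivation h x y
    simp only [mul_sub, sub_mul, mul_assoc] at this ⊢
    linear_combination (norm := abel) this

end IsPeirceFrame

section JordanProduct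

variable {A : Type*} [Ring A]

theorem foldl_jordan_replicate_one (m : ℕ) (x : A) :
    (List.replicate m 1).foldl (fun x y => x * y + y * x) x = 2 ^ m • x := by
  induction m generalizing x with
  | zero => simp
  | succ m ih =>
    rw [List.replicate_succ, List.foldl_cons, ih, mul_one, one_mul, ← two_smul ℕ x, ← mul_smul,
      pow_succ]

theorem two_smul_foldl_jordan_set (m i : ℕ) (hi : i < m) (c x : A) :
    2 • ((List.replicate m 1).set i c).foldl (fun x y => x * y + y * x) x =
      2 ^ m • (x * c + c * x) := by
  induction m generalizing x i with
  | zero => omega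
  | succ m ih =>
    cases i with
    | zero =>
      rw [List.replicate_succ, List.set_cons_zero, List.foldl_cons, foldl_jordan_replicate_one,
        ← mul_smul, pow_succ']
    | succ i =>
      rw [List.replicate_succ, List.set_cons_succ, List.foldl_cons, ih i (by omega), mul_one,
        one_mul, ← two_smul ℕ x, smul_mul_assoc, mul_smul_comm, ← smul_add, ← mul_smul, pow_succ]

theorem IsMulJordanDeriv.two_smul_map {m : ℕ} {δ : A → A} (hδ : IsMulJordanDeriv (m + 2) δ)
    (t s : A) : 2 • δ (2 ^ m • (t * s + s * t)) = 2 ^ m •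
      (2 • (δ t * s + s * δ t + (t * δ s + δ s * t)) +
        m • ((t * s + s * t) * δ 1 + δ 1 * (t * s + s * t))) := by
  have h₁ := hδ (t :: s :: List.replicate m 1) (by simp)
  rw [Finset.sum_range_succ', Finset.sum_range_succ'] at h₁
  simp only [List.set_cons_succ, List.set_cons_zero, List.getD_cons_succ, List.getD_cons_zero,
    jordanProd, List.foldl_cons, foldl_jordan_replicate_one] at h₁
  have h₂ : 2 • ∑ i ∈ Finset.range m, List.foldl (fun x y => x * y + y * x) (t * s + s * t)
      ((List.replicate m 1).set i (δ ((List.replicate m 1).getD i 0))) =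
      2 ^ m • m • ((t * s + s * t) * δ 1 + δ 1 * (t * s + s * t)) := by
    rw [Finset.smul_sum, Finset.sum_congr rfl (g := fun _ =>
      2 ^ m • ((t * s + s * t) * δ 1 + δ 1 * (t * s + s * t)))]
    · rw [Finset.sum_const, Finset.card_range, smul_comm]
    · intro i hi
      have hi' := Finset.mem_range.mp hi
      rw [two_smul_foldl_jordan_set m i hi']
      simp [List.getD, hi']
  rw [h₁, smul_add, smul_add, h₂, smul_comm 2 (2 ^ m), smul_comm 2 (2 ^ m)]
  simp only [smul_add]
  abel

theorem IsMulGenJordanDeriv.map_sub {m : ℕ} {Δ δ : A → A} (hδ : IsMulJordanDeriv (m + 2) δ)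
    (hΔ : IsMulGenJordanDeriv (m + 2) Δ δ) (t s : A) :
    (Δ - δ) (2 ^ m • (t * s + s * t)) = 2 ^ m • ((Δ - δ) t * s + s * (Δ - δ) t) := by
  have hl : (t :: s :: List.replicate m 1).length = m + 2 := by simp
  have h₁ := hδ _ hl
  have h₂ := hΔ _ hl
  rw [Finset.range_eq_Ico, Finset.sum_eq_sum_Ico_succ_bot (by omega)] at h₁
  have h₃ := congrArg₂ (· - ·) h₂ h₁
  simp only [zero_add, add_sub_add_right_eq_sub] at h₃
  simp only [List.set_cons_zero, List.getD_cons_zero, jordanProd, List.foldl_cons,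
    foldl_jordan_replicate_one, ← smul_sub] at h₃
  rw [Pi.sub_apply, h₃, Pi.sub_apply, sub_mul, mul_sub]
  congr 1
  abel

end JordanProduct

theorem Matrix.isPeirceFrame (k : ℕ) (R : Type*) [Ring R] :
    IsPeirceFrame (A := Matrix (Fin (k + 2)) (Fin (k + 2)) R)
      (Matrix.single 0 0 1) (Matrix.single 0 1 1) (Matrix.single 1 0 1) where
  idem := by simp
  ev := by simp
  ve := by simp
  ew := by simp
  we := by simp
  vw := by simp
  faithful b hb := by
    ext i j
    by_cases hi : i = 0
    · subst hi
      simp [sub_mul]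
    · have h₁ := hb (Matrix.single 0 i 1) (by simp) (by simp [hi])
      have h₂ := congrFun (congrFun h₁ 0) j
      rw [Matrix.single_mul_apply_same, one_mul] at h₂
      simp [sub_mul, Matrix.single_mul_apply_of_ne _ _ _ _ _ hi, h₂]

/-- Every multiplicative generalized Jordan `n`-derivation of the full `r × r` matrix
ring over a 2-torsion-free unital ring `R` has the form `Δ(t) = μt + δ(t)` with `μ`
central and `δ` a derivation. -/
theorem stmt_8 (n r : ℕ) (hn : 2 ≤ n) (hr : 2 ≤ r)
    (R : Type*) [Ring R] (h2 : ∀ t : R, 2 * t = 0 → t = 0)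
    (Δ δ₀ : Matrix (Fin r) (Fin r) R → Matrix (Fin r) (Fin r) R)
    (hδ₀ : IsMulJordanDeriv n δ₀) (hΔ : IsMulGenJordanDeriv n Δ δ₀) :
    ∃ μ : Matrix (Fin r) (Fin r) R,
      ∃ δ : Matrix (Fin r) (Fin r) R → Matrix (Fin r) (Fin r) R,
      (∀ a : Matrix (Fin r) (Fin r) R, μ * a = a * μ) ∧
      (∀ x y : Matrix (Fin r) (Fin r) R, δ (x + y) = δ x + δ y) ∧
      (∀ x y : Matrix (Fin r) (Fin r) R, δ (x * y) = δ x * y + x * δ y) ∧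
      ∀ t : Matrix (Fin r) (Fin r) R, Δ t = μ * t + δ t := by
  obtain ⟨m, rfl⟩ := Nat.exists_eq_add_of_le' hn
  obtain ⟨k, rfl⟩ := Nat.exists_eq_add_of_le' hr
  have h := Matrix.isPeirceFrame k R
  have hA : ∀ x : Matrix (Fin (k + 2)) (Fin (k + 2)) R, x + x = 0 → x = 0 := by
    intro x hx
    ext i j
    exact h2 _ ((two_mul _).trans (congrFun (congrFun hx i) j))
  have hK : ∀ (j : ℕ) (x : Matrix (Fin (k + 2)) (Fin (k + 2)) R), 2 ^ j • x = 0 → x = 0 := by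
    intro j
    induction j with
    | zero => simp
    | succ j ih =>
      intro x hx
      rw [pow_succ, mul_smul] at hx
      exact hA x ((two_smul ℕ x).symm.trans (ih _ hx))
  obtain ⟨a, ha, hΦ⟩ := h.exists_central_mul hA (hK m) (hΔ.map_sub hδ₀)
  obtain ⟨c, d, hc, hadd, hmul, hδ⟩ := h.exists_central_add_derivation hA hK hδ₀.two_smul_map
  refine ⟨a + c, d, fun x => by rw [add_mul, mul_add, ha, hc], hadd, hmul, fun t => ?_⟩
  rw [add_mul, add_assoc, ← hδ, ← hΦ, Pi.sub_apply, sub_add_cancel]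
end

section
/- Let n ≥ 2 be an integer and let A be a 2-torsion-free unital prime ring containing a nontrivial idempotent (an idempotent e with e ≠ 0 and e ≠ 1). Then every multiplicative generalized Jordan n-derivation Δ : A → A can be expressed as Δ(t) = μt + δ(t) for all t ∈ A, where μ lies in the center Z(A) and δ : A → A is a derivation. -/
section

variable {A : Type*} [Ring A]

/-- A map `D` satisfying, up to the scalar `2 ^ k` and a central twist `γ`, the Leibniz rule for the
Jordan product on a 2-torsion-free prime ring, and vanishing on complementary nonzero
idempotents `e` and `f`. -/
structure ScaledJordanDeriv (e f : A) (k : ℕ) (γ : A) (D : A → A) : Prop where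
  two_torsion : ∀ t : A, (2 : ℤ) • t = 0 → t = 0
  prime : ∀ u v : A, (∀ a : A, u * a * v = 0) → u = 0 ∨ v = 0
  idem : e * e = e
  compl : f = 1 - e
  left_ne : e ≠ 0
  right_ne : f ≠ 0
  central : ∀ a : A, γ * a = a * γ
  map_left : D e = 0
  map_right : D f = 0
  map_one : D 1 = 0
  leibniz : ∀ x y : A, D ((2 : ℤ) ^ k • (x * y + y * x)) =
    (2 : ℤ) ^ k • (D x * y + y * D x + (x * D y + D y * x) + γ * (x * y + y * x))

theorem two_pow_smul_eq_zero (h2 : ∀ t : A, (2 : ℤ) • t = 0 → t = 0) (k : ℕ) (t : A)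
    (h : (2 : ℤ) ^ k • t = 0) : t = 0 := by
  induction k with
  | zero => simpa using h
  | succ k ih => exact ih (h2 _ (by rw [← h, smul_smul, pow_succ, mul_comm]))

theorem idem_mul_cancel {e : A} (h : e * e = e) (t : A) : e * (e * t) = e * t := by
  rw [← mul_assoc, h]

theorem half_mul_idem {e x : A} (h : e * x + x * e = x) : x * e = x - e * x :=
  eq_sub_of_add_eq' h

theorem half_mul_idem_mul {e x : A} (h : e * x + x * e = x) (t : A) :
    x * (e * t) = x * t - e * (x * t) := by
  rw [← mul_assoc, half_mul_idem h, sub_mul, mul_assoc]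

/-- The off-diagonal part of `x` in the Peirce decomposition given by `e` and `f`. -/
def offDiag (e f x : A) : A := e * x * f + f * x * e

theorem offDiag_swap (e f x : A) : offDiag f e x = offDiag e f x := add_comm _ _

theorem offDiag_half {e f : A} (h : e * e = e) (hf : f = 1 - e) (x : A) :
    e * offDiag e f x + offDiag e f x * e = offDiag e f x := by
  subst hf
  simp only [offDiag, mul_add, add_mul, mul_sub, sub_mul, mul_assoc, one_mul, mul_one, h,
    idem_mul_cancel h]
  abel

theorem offDiag_eq_self {e f x : A} (hee : e * e = e) (hf : f = 1 - e) (h : e * x + x * e = x) :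
    offDiag e f x = x := by
  subst hf
  have h1 : e * (x * e) = 0 := by
    have := congrArg (fun t => e * t) h
    rw [mul_add, idem_mul_cancel hee] at this
    exact add_eq_left.1 this
  simp only [offDiag, mul_sub, sub_mul, one_mul, mul_one, mul_assoc, h1]
  rw [sub_zero, sub_zero, h]

theorem eq_add_offDiag_add {e f : A} (hf : f = 1 - e) (x : A) :
    x = e * x * e + offDiag e f x + f * x * f := by
  subst hf
  simp only [offDiag, mul_sub, sub_mul, mul_assoc, one_mul, mul_one]
  abel

namespace ScaledJordanDeriv

variable {e f γ : A} {k : ℕ} {D : A → A}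

theorem cancel (h : ScaledJordanDeriv e f k γ D) {x y : A}
    (hxy : (2 : ℤ) ^ k • x = (2 : ℤ) ^ k • y) : x = y :=
  sub_eq_zero.1 (two_pow_smul_eq_zero h.two_torsion k _ (by rw [smul_sub, hxy, sub_self]))

theorem cancel_two (h : ScaledJordanDeriv e f k γ D) {x y : A}
    (hxy : (2 : ℤ) • x = (2 : ℤ) • y) : x = y :=
  sub_eq_zero.1 (h.two_torsion _ (by rw [smul_sub, hxy, sub_self]))

theorem swap (h : ScaledJordanDeriv e f k γ D) : ScaledJordanDeriv f e k γ D where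
  __ := h
  idem := by
    rw [h.compl]
    simp only [mul_sub, sub_mul, one_mul, mul_one, h.idem]
    abel
  compl := by rw [h.compl]; abel
  left_ne := h.right_ne
  right_ne := h.left_ne
  map_left := h.map_right
  map_right := h.map_left

theorem map_zero (h : ScaledJordanDeriv e f k γ D) : D 0 = 0 := by
  have := h.leibniz e f
  have hef : e * f = 0 := by rw [h.compl, mul_sub, h.idem, mul_one, sub_self]
  have hfe : f * e = 0 := by rw [h.compl, sub_mul, h.idem, one_mul, sub_self]
  simpa [h.map_left, h.map_right, hef, hfe] using this

theorem half_right (h : ScaledJordanDeriv e f k γ D) {x : A} (hx : e * x + x * e = x) :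
    f * x + x * f = x := by
  rw [h.compl, sub_mul, mul_sub, half_mul_idem hx]
  simp only [one_mul, mul_one]
  abel

theorem map_half (h : ScaledJordanDeriv e f k γ D) {x : A} (hx : e * x + x * e = x) :
    e * D x + D x * e = D x := by
  have h1 := h.leibniz e x
  have h2 := h.leibniz f x
  rw [h.half_right hx] at h2
  rw [hx, h2] at h1
  have h3 := h.cancel h1
  rw [h.map_left, h.map_right, h.compl] at h3
  simp only [sub_mul, mul_sub, one_mul, mul_one, mul_zero, zero_mul] at h3
  apply h.cancel_two
  linear_combination (norm := module) -h3

theorem map_scaled_half (h : ScaledJordanDeriv e f k γ D) {x : A} (hx : e * x + x * e = x) :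
    D ((2 : ℤ) ^ k • x) = (2 : ℤ) ^ k • (D x + γ * x) := by
  have h1 := h.leibniz e x
  rw [hx, h.map_left, h.map_half hx] at h1
  simpa using h1

theorem map_two_half (h : ScaledJordanDeriv e f k γ D) {x : A} (hx : e * x + x * e = x) :
    D ((2 : ℤ) • x) = (2 : ℤ) • D x := by
  have h1 := h.leibniz 1 x
  have hx2 : e * ((2 : ℤ) • x) + ((2 : ℤ) • x) * e = (2 : ℤ) • x := by
    rw [mul_smul_comm, smul_mul_assoc, ← smul_add, hx]
  have h2 := h.map_scaled_half hx2
  rw [show 1 * x + x * 1 = (2 : ℤ) • x by rw [one_mul, mul_one, two_smul], h2] at h1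
  have h3 := h.cancel h1
  simp only [h.map_one, one_mul, mul_one, mul_zero, zero_mul] at h3
  linear_combination (norm := module) h3

theorem map_two_pow_half (h : ScaledJordanDeriv e f k γ D) (m : ℕ) {x : A}
    (hx : e * x + x * e = x) : D ((2 : ℤ) ^ m • x) = (2 : ℤ) ^ m • D x := by
  induction m with
  | zero => simp
  | succ m ih =>
    have hm : e * ((2 : ℤ) ^ m • x) + ((2 : ℤ) ^ m • x) * e = (2 : ℤ) ^ m • x := by
      rw [mul_smul_comm, smul_mul_assoc, ← smul_add, hx]
    rw [pow_succ', ← smul_smul, ← smul_smul, h.map_two_half hm, ih]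

theorem twist_eq_zero (h : ScaledJordanDeriv e f k γ D) : γ = 0 := by
  have key : ∀ a : A, γ * e * a * f = 0 := fun a => by
    have hx : e * (e * a * f) + (e * a * f) * e = e * a * f := by
      have hfe : f * e = 0 := by rw [h.compl, sub_mul, h.idem, one_mul, sub_self]
      rw [mul_assoc (e * a), hfe, mul_assoc e a f, idem_mul_cancel h.idem, mul_zero, add_zero]
    have h1 := h.cancel ((h.map_two_pow_half k hx).symm.trans (h.map_scaled_half hx))
    simpa [mul_assoc] using h1
  have h1 := (h.prime _ _ key).resolve_right h.right_ne
  exact (h.prime γ e fun a => by rw [h.central, mul_assoc, h1, mul_zero]).resolve_right h.left_ne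

theorem leibniz' (h : ScaledJordanDeriv e f k γ D) (x y : A) :
    D ((2 : ℤ) ^ k • (x * y + y * x)) =
      (2 : ℤ) ^ k • (D x * y + y * D x + (x * D y + D y * x)) := by
  rw [h.leibniz, h.twist_eq_zero, zero_mul, add_zero]

theorem left_mul_right (h : ScaledJordanDeriv e f k γ D) : e * f = 0 := by
  rw [h.compl, mul_sub, h.idem, mul_one, sub_self]

theorem right_mul_left (h : ScaledJordanDeriv e f k γ D) : f * e = 0 :=
  h.swap.left_mul_right

theorem corner_half (h : ScaledJordanDeriv e f k γ D) (a : A) :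
    e * (e * a * f) + (e * a * f) * e = e * a * f := by
  rw [mul_assoc (e * a), h.right_mul_left, mul_assoc e a f, idem_mul_cancel h.idem, mul_zero,
    add_zero]

theorem map_offDiag (h : ScaledJordanDeriv e f k γ D) (x : A) :
    D (offDiag e f x) = offDiag e f (D x) := by
  have key : ∀ y : A, (e * y + y * e) * f + f * (e * y + y * e) = offDiag e f y := fun y => by
    rw [offDiag, add_mul, mul_add, mul_assoc y e f, h.left_mul_right, ← mul_assoc f e y,
      h.right_mul_left, mul_assoc f y e]
    simp
  have h1 := h.leibniz' e x
  have h2 := h.leibniz' ((2 : ℤ) ^ k • (e * x + x * e)) f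
  rw [h1] at h2
  simp only [h.map_left, h.map_right, zero_mul, mul_zero, zero_add, add_zero, smul_mul_assoc,
    mul_smul_comm, ← smul_add, key] at h2
  have hx := offDiag_half h.idem h.compl x
  have hx' : e * ((2 : ℤ) ^ k • offDiag e f x) + ((2 : ℤ) ^ k • offDiag e f x) * e =
      (2 : ℤ) ^ k • offDiag e f x := by
    rw [mul_smul_comm, smul_mul_assoc, ← smul_add, hx]
  rw [h.map_two_pow_half k hx', h.map_two_pow_half k hx] at h2
  exact h.cancel (h.cancel h2)

theorem offDiag_add (e f x y : A) : offDiag e f (x + y) = offDiag e f x + offDiag e f y := by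
  simp only [offDiag, mul_add, add_mul]
  abel

theorem offDiag_smul (e f : A) (m : ℤ) (x : A) : offDiag e f (m • x) = m • offDiag e f x := by
  simp only [offDiag, mul_smul_comm, smul_mul_assoc, smul_add]

theorem jordan_right (h : ScaledJordanDeriv e f k γ D) (x : A) :
    x * f + f * x = offDiag e f x + (2 : ℤ) • (f * x * f) := by
  rw [h.compl]
  simp only [offDiag, mul_sub, sub_mul, mul_assoc, one_mul, mul_one]
  module

theorem map_scaled_offDiag (h : ScaledJordanDeriv e f k γ D) (x : A) :
    D ((2 : ℤ) ^ k • offDiag e f x) = (2 : ℤ) ^ k • offDiag e f (D x) := by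
  rw [h.map_two_pow_half k (offDiag_half h.idem h.compl x), h.map_offDiag]

theorem corner_map_eq_zero (h : ScaledJordanDeriv e f k γ D) {x : A} (hx : f * x * f = 0) :
    f * D x * f = 0 := by
  have h1 := h.leibniz' x f
  rw [h.jordan_right x, hx, smul_zero, add_zero, h.map_scaled_offDiag, h.map_right, mul_zero,
    zero_mul, add_zero, add_zero, h.jordan_right] at h1
  exact h.two_torsion _ (left_eq_add.1 (h.cancel h1))

theorem offDiag_jordan_half (h : ScaledJordanDeriv e f k γ D) (x : A) {z : A}
    (hz : e * z + z * e = z) :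
    offDiag e f (x * z + z * x) =
      (e * x * e) * z + z * (e * x * e) + ((f * x * f) * z + z * (f * x * f)) := by
  rw [h.compl]
  simp only [offDiag, mul_sub, sub_mul, mul_add, add_mul, mul_assoc, one_mul, mul_one,
    half_mul_idem hz, half_mul_idem_mul hz]
  abel

theorem map_diag_jordan_half (h : ScaledJordanDeriv e f k γ D) (x : A) {z : A}
    (hz : e * z + z * e = z) :
    D ((e * x * e) * z + z * (e * x * e) + ((f * x * f) * z + z * (f * x * f))) =
      (e * D x * e) * z + z * (e * D x * e) + ((f * D x * f) * z + z * (f * D x * f)) +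
      ((e * x * e) * D z + D z * (e * x * e) + ((f * x * f) * D z + D z * (f * x * f))) := by
  have h1 := h.map_scaled_offDiag (x * z + z * x)
  have h2 := h.map_offDiag ((2 : ℤ) ^ k • (x * z + z * x))
  rw [h.leibniz', offDiag_smul, offDiag_smul, offDiag_add e f (D x * z + z * D x)] at h2
  rw [h2] at h1
  rw [← h.offDiag_jordan_half x hz, ← h.offDiag_jordan_half (D x) hz,
    ← h.offDiag_jordan_half x (h.map_half hz), h.map_offDiag]
  exact (h.cancel h1).symm

theorem corner_eq_zero (h : ScaledJordanDeriv e f k γ D) {x : A}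
    (hx : ∀ a, (e * x * e) * (e * a * f) + (e * a * f) * (e * x * e) = 0) : e * x * e = 0 := by
  refine (h.prime (e * x * e) f fun a => ?_).resolve_right h.right_ne
  have h1 := hx a
  rw [mul_assoc (e * a) f, ← mul_assoc f, ← mul_assoc f, h.right_mul_left] at h1
  simpa [mul_assoc, idem_mul_cancel h.idem] using h1

theorem corner_map_of_corner_eq_zero (h : ScaledJordanDeriv e f k γ D) {x : A}
    (hx : f * x * f = 0) : e * D x * e = D (e * x * e) := by
  have hx' : f * (e * x * e) * f = 0 := by
    simp [← mul_assoc, h.right_mul_left]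
  have hxe : e * (e * x * e) * e = e * x * e := by
    simp only [mul_assoc, h.idem, idem_mul_cancel h.idem]
  have h0 : offDiag e f (D (e * x * e)) = 0 := by
    rw [← h.map_offDiag, ← h.map_zero]
    congr 1
    simp only [offDiag, ← mul_assoc, h.right_mul_left, zero_mul, add_zero]
    rw [mul_assoc _ e f, h.left_mul_right, mul_zero]
  have h1 : e * (D x - D (e * x * e)) * e = 0 := by
    refine h.corner_eq_zero fun a => ?_
    have e1 := h.map_diag_jordan_half x (h.corner_half a)
    have e2 := h.map_diag_jordan_half (e * x * e) (h.corner_half a)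
    rw [hx, h.corner_map_eq_zero hx] at e1
    rw [hx', h.corner_map_eq_zero hx', hxe, e1] at e2
    rw [mul_sub, sub_mul, mul_sub, sub_mul]
    linear_combination (norm := module) e2
  have h2 := eq_add_offDiag_add h.compl (D (e * x * e))
  rw [h0, h.corner_map_eq_zero hx', add_zero, add_zero] at h2
  rw [h2, ← sub_eq_zero, ← sub_mul, ← mul_sub, h1]

theorem corner_map (h : ScaledJordanDeriv e f k γ D) (x : A) :
    e * D x * e = D (e * x * e) := by
  have hy : f * ((2 : ℤ) ^ k • (e * x + x * e)) * f = 0 := by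
    rw [mul_smul_comm, smul_mul_assoc, mul_add, add_mul, ← mul_assoc f e, h.right_mul_left,
      mul_assoc f (x * e), mul_assoc x, h.left_mul_right]
    simp
  have hc : ∀ y : A, e * (e * y + y * e) * e = (2 : ℤ) • (e * y * e) := fun y => by
    simp only [mul_add, add_mul, mul_assoc, h.idem, idem_mul_cancel h.idem, two_smul]
  have h1 := h.corner_map_of_corner_eq_zero hy
  have h2 := h.leibniz' 1 (e * x * e)
  rw [h.leibniz', mul_smul_comm, smul_mul_assoc, mul_smul_comm, smul_mul_assoc, hc,
    h.map_left, zero_mul, mul_zero, add_zero, zero_add, hc] at h1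
  simp only [h.map_one, one_mul, mul_one, zero_mul, mul_zero, add_zero, zero_add] at h2
  rw [← two_smul ℤ, ← two_smul ℤ] at h2
  rw [h2] at h1
  exact h.cancel_two (h.cancel h1)

theorem map_eq (h : ScaledJordanDeriv e f k γ D) (x : A) :
    D x = D (e * x * e) + D (offDiag e f x) + D (f * x * f) := by
  rw [← h.corner_map, ← h.swap.corner_map, h.map_offDiag]
  exact eq_add_offDiag_add h.compl _

theorem map_left_add (h : ScaledJordanDeriv e f k γ D) {x : A} (hx : e * x + x * e = x) :
    D (e + x) = D x := by
  have hxe : e * (x * e) = 0 := by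
    have := congrArg (fun t => e * t) hx
    rw [mul_add, idem_mul_cancel h.idem] at this
    exact add_eq_left.1 this
  have h1 : e * (e + x) * e = e := by
    simp only [mul_add, add_mul, mul_assoc, hxe, h.idem, add_zero]
  have h2 : f * (e + x) * f = 0 := by
    rw [h.compl]
    simp only [mul_add, add_mul, mul_sub, sub_mul, mul_assoc, one_mul, mul_one, hxe, h.idem]
    rw [half_mul_idem hx]
    abel
  have h3 : offDiag e f (e + x) = x := by
    rw [offDiag_add, offDiag_eq_self h.idem h.compl hx, offDiag, mul_assoc, h.left_mul_right,
      h.right_mul_left]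
    simp
  rw [h.map_eq, h1, h2, h3, h.map_left, h.map_zero, zero_add, add_zero]

theorem map_add_half (h : ScaledJordanDeriv e f k γ D) {x y : A} (hx : e * x + x * e = x)
    (hy : e * y + y * e = y) : D (x + y) = D x + D y := by
  have key : ∀ x y : A, e * x + x * e = x → e * y + y * e = y →
      offDiag e f (x * y + y * x) = 0 := fun x y hx hy => by
    rw [h.offDiag_jordan_half x hy, h.compl]
    simp only [mul_sub, sub_mul, mul_assoc, one_mul, mul_one, half_mul_idem hx,
      half_mul_idem_mul hy, idem_mul_cancel h.idem]
    abel
  have key2 : ∀ x y : A, e * x + x * e = x → e * y + y * e = y →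
      offDiag e f (x * (f + y) + (f + y) * x) = x := fun x y hx hy => by
    rw [show x * (f + y) + (f + y) * x = (f * x + x * f) + (x * y + y * x) by
      rw [mul_add, add_mul]; abel, offDiag_add, key x y hx hy, h.half_right hx, add_zero,
      offDiag_eq_self h.idem h.compl hx]
  have key3 : ∀ x y : A, e * x + x * e = x → e * y + y * e = y →
      offDiag e f ((e + x) * y + y * (e + x)) = y := fun x y hx hy => by
    rw [show (e + x) * y + y * (e + x) = (e * y + y * e) + (x * y + y * x) by
      rw [mul_add, add_mul]; abel, offDiag_add, key x y hx hy, hy, add_zero,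
      offDiag_eq_self h.idem h.compl hy]
  have key4 : offDiag e f ((e + x) * (f + y) + (f + y) * (e + x)) = x + y := by
    rw [show (e + x) * (f + y) + (f + y) * (e + x) =
      e * f + f * e + (x * (f + y) + (f + y) * x) + (e * y + y * e) by
        simp only [mul_add, add_mul]; abel, h.left_mul_right, h.right_mul_left, add_zero,
      zero_add, offDiag_add, key2 x y hx hy, hy, offDiag_eq_self h.idem h.compl hy]
  have h1 := h.map_scaled_offDiag ((e + x) * (f + y) + (f + y) * (e + x))
  have h2 := h.map_offDiag ((2 : ℤ) ^ k • ((e + x) * (f + y) + (f + y) * (e + x)))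
  rw [offDiag_smul, h1, h.leibniz', offDiag_smul, h.map_left_add hx,
    h.swap.map_left_add (h.half_right hy), offDiag_add,
    key2 _ y (h.map_half hx) hy, key3 x _ hx (h.map_half hy), ← h.map_offDiag, key4] at h2
  exact h.cancel h2

theorem map_add_corner (h : ScaledJordanDeriv e f k γ D) (x y : A) :
    D (e * (x + y) * e) = D (e * x * e) + D (e * y * e) := by
  have hc : ∀ x, f * (e * x * e) * f = 0 := fun x => by simp [← mul_assoc, h.right_mul_left]
  have hc' : ∀ x, e * (e * x * e) * e = e * x * e := fun x => by
    simp only [mul_assoc, h.idem, idem_mul_cancel h.idem]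
  have hh : ∀ x a, e * ((e * x * e) * (e * a * f) + (e * a * f) * (e * x * e)) +
      ((e * x * e) * (e * a * f) + (e * a * f) * (e * x * e)) * e =
        (e * x * e) * (e * a * f) + (e * a * f) * (e * x * e) := fun x a => by
    have := offDiag_half h.idem h.compl ((e * x * e) * (e * a * f) + (e * a * f) * (e * x * e))
    rwa [h.offDiag_jordan_half _ (h.corner_half a), hc, hc', zero_mul, mul_zero, add_zero,
      add_zero] at this
  have h1 : e * (D (e * (x + y) * e) - D (e * x * e) - D (e * y * e)) * e = 0 := by
    refine h.corner_eq_zero fun a => ?_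
    have e1 := h.map_diag_jordan_half (e * x * e) (h.corner_half a)
    have e2 := h.map_diag_jordan_half (e * y * e) (h.corner_half a)
    have e3 := h.map_diag_jordan_half (e * (x + y) * e) (h.corner_half a)
    simp only [hc, hc', h.corner_map_eq_zero (hc _), zero_mul, mul_zero, add_zero] at e1 e2 e3
    have e4 := h.map_add_half (hh x a) (hh y a)
    rw [e1, e2, show e * x * e * (e * a * f) + e * a * f * (e * x * e) +
        (e * y * e * (e * a * f) + e * a * f * (e * y * e)) =
        e * (x + y) * e * (e * a * f) + e * a * f * (e * (x + y) * e) by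
      simp only [mul_add, add_mul]; abel, e3] at e4
    simp only [mul_sub, sub_mul, mul_add, add_mul] at e4 ⊢
    linear_combination (norm := module) e4
  rw [mul_sub, mul_sub, sub_mul, sub_mul, h.corner_map, h.corner_map, h.corner_map, hc', hc',
    hc', sub_sub] at h1
  exact sub_eq_zero.1 h1

theorem map_add (h : ScaledJordanDeriv e f k γ D) (x y : A) : D (x + y) = D x + D y := by
  rw [h.map_eq, h.map_eq x, h.map_eq y, h.map_add_corner, h.swap.map_add_corner, offDiag_add,
    h.map_add_half (offDiag_half h.idem h.compl x) (offDiag_half h.idem h.compl y)]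
  abel

theorem map_zsmul (h : ScaledJordanDeriv e f k γ D) (m : ℤ) (x : A) : D (m • x) = m • D x :=
  _root_.map_zsmul (AddMonoidHom.mk' D h.map_add) m x

theorem map_jordan (h : ScaledJordanDeriv e f k γ D) (x y : A) :
    D (x * y + y * x) = D x * y + y * D x + (x * D y + D y * x) :=
  h.cancel (by rw [← h.leibniz', h.map_zsmul])

theorem right_mul_of_left_mul (h : ScaledJordanDeriv e f k γ D) {z : A} (hz : e * z = z) :
    f * z = 0 := by
  rw [h.compl, sub_mul, hz, one_mul, sub_self]

theorem upper_mul_upper {e y z : A} (hy : y * e = 0) (hz : e * z = z) : y * z = 0 := by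
  rw [← hz, ← mul_assoc, hy, zero_mul]

theorem lower_map_upper (h : ScaledJordanDeriv e f k γ D) {z : A} (hz : e * z = z)
    (hz' : z * e = 0) : f * D z * e = 0 := by
  have jordan : ∀ y, e * y = y → y * e = 0 → D y * z + z * D y + (y * D z + D z * y) = 0 :=
    fun y hy hy' => by
      rw [← h.map_jordan, upper_mul_upper hy' hz, upper_mul_upper hz' hy, add_zero, h.map_zero]
  have h1 : f * D z * z = 0 := by
    refine h.two_torsion _ ?_
    have := congrArg (fun t => f * t) (jordan z hz hz')
    simp only [mul_add, mul_zero, ← mul_assoc, h.right_mul_of_left_mul hz, zero_mul] at this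
    rw [two_smul]
    simpa using this
  have h2 : ∀ y, e * y = y → y * e = 0 → y * D z * e = -(z * D y * e) := fun y hy hy' => by
    have := congrArg (fun t => t * e) (jordan y hy hy')
    simp only [add_mul, zero_mul, mul_assoc, hz', hy', mul_zero] at this
    rw [eq_neg_iff_add_eq_zero, mul_assoc, mul_assoc]
    simpa [add_comm] using this
  refine (or_self_iff).1 (h.prime _ _ fun a => ?_)
  have hy : e * (e * a * f) = e * a * f := by
    rw [mul_assoc, idem_mul_cancel h.idem]
  have hy' : e * a * f * e = 0 := by rw [mul_assoc, h.right_mul_left, mul_zero]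
  calc f * D z * e * a * (f * D z * e) = f * D z * (e * a * f * D z * e) := by
        simp only [mul_assoc]
    _ = -(f * D z * z * (D (e * a * f) * e)) := by
        rw [h2 _ hy hy', mul_neg]
        simp only [mul_assoc]
    _ = 0 := by rw [h1, zero_mul, neg_zero]

theorem upper_map_lower (h : ScaledJordanDeriv e f k γ D) (x : A) :
    e * D (f * x * e) * f = 0 := by
  refine h.swap.lower_map_upper ?_ ?_
  · rw [mul_assoc, idem_mul_cancel h.swap.idem]
  · rw [mul_assoc, h.left_mul_right, mul_zero]

theorem map_upper (h : ScaledJordanDeriv e f k γ D) (x : A) :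
    e * D x * f = D (e * x * f) := by
  have hc : ∀ y, e * offDiag e f y * f = e * y * f := fun y => by
    rw [offDiag, mul_add, add_mul, ← mul_assoc e (f * y), ← mul_assoc e f, h.left_mul_right,
      mul_assoc e y f, idem_mul_cancel h.idem, mul_assoc e, mul_assoc y, h.swap.idem]
    simp
  have h1 : D (e * x * f) = e * D (e * x * f) * f := by
    have h2 := offDiag_eq_self h.idem h.compl (h.map_half (h.corner_half x))
    rw [offDiag, h.lower_map_upper (by rw [mul_assoc, idem_mul_cancel h.idem])
      (by rw [mul_assoc, h.right_mul_left, mul_zero]), add_zero] at h2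
    exact h2.symm
  rw [h1, ← hc, ← h.map_offDiag, offDiag, h.map_add, mul_add, add_mul, h.upper_map_lower,
    add_zero]

theorem left_add_right (h : ScaledJordanDeriv e f k γ D) : e + f = 1 := by
  rw [h.compl]; abel

theorem map_left_mul (h : ScaledJordanDeriv e f k γ D) (x : A) : D (e * x) = e * D x := by
  rw [← mul_one (e * x), ← h.left_add_right, mul_add, h.map_add, ← h.corner_map, ← h.map_upper,
    ← mul_add, h.left_add_right, mul_one]

theorem map_mul_left (h : ScaledJordanDeriv e f k γ D) (x : A) : D (x * e) = D x * e := by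
  have h1 := h.map_jordan e x
  rw [h.map_add, h.map_left_mul, h.map_left, zero_mul, mul_zero, zero_add, zero_add] at h1
  exact add_left_cancel h1

theorem map_mul_upper (h : ScaledJordanDeriv e f k γ D) (a : A) {z : A} (hz : e * z = z)
    (hz' : z * e = 0) : D (a * z) = D a * z + a * D z := by
  have hD : e * D z = D z := by rw [← h.map_left_mul, hz]
  have hD' : D z * e = 0 := by rw [← h.map_mul_left, hz', h.map_zero]
  have h1 : D (e * (a * z)) = e * (D a * z + a * D z) := by
    have := h.map_jordan (e * a * e) z
    rw [h.map_mul_left, h.map_left_mul, mul_assoc e a e, ← mul_assoc z e, ← mul_assoc z,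
      ← mul_assoc (D z) e, mul_assoc e (D a) e, ← mul_assoc z e, hz', hD'] at this
    simpa only [mul_assoc, hz, hD, zero_mul, add_zero, mul_add] using this
  have h2 : D (f * (a * z)) = f * (D a * z + a * D z) := by
    have hfz := h.right_mul_of_left_mul hz
    have hfD := h.right_mul_of_left_mul hD
    have h3 := h.swap.map_left_mul (f * a * e * z + z * (f * a * e))
    have h4 : f * (f * a * e * z + z * (f * a * e)) = f * (a * z) := by
      rw [mul_add, ← mul_assoc f z, hfz, zero_mul, add_zero]
      simp only [mul_assoc, hz, idem_mul_cancel h.swap.idem]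
    rw [h4, h.map_jordan, h.map_mul_left, h.swap.map_left_mul a] at h3
    rw [h3]
    simp only [mul_add, ← mul_assoc f z, ← mul_assoc f (D z), hfz, hfD, zero_mul, add_zero]
    simp only [mul_assoc, hz, hD, idem_mul_cancel h.swap.idem]
  rw [← one_mul (a * z), ← h.left_add_right, add_mul, h.map_add, h1, h2, ← add_mul,
    h.left_add_right, one_mul]

theorem map_mul_mul_left (h : ScaledJordanDeriv e f k γ D) (x y : A) :
    D (x * y) * e = (D x * y + x * D y) * e := by
  rw [← sub_eq_zero, ← sub_mul]
  refine (h.prime _ f fun b => ?_).resolve_right h.right_ne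
  set z := e * b * f with hzdef
  have hz : e * z = z := by rw [hzdef, mul_assoc, idem_mul_cancel h.idem]
  have hz' : z * e = 0 := by rw [hzdef, mul_assoc, h.right_mul_left, mul_zero]
  have hD : e * D z = D z := by rw [← h.map_left_mul, hz]
  have h1 := h.map_mul_upper (x * y) hz hz'
  have h2 := h.map_mul_upper x (z := e * (y * z)) (idem_mul_cancel h.idem _)
    (by rw [mul_assoc, mul_assoc, hz', mul_zero, mul_zero])
  have h3 := h.map_mul_upper (x * (f * y * e)) hz hz'
  have h4 := h.swap.map_mul_upper x (z := f * y * e)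
    (by rw [mul_assoc, idem_mul_cancel h.swap.idem])
    (by rw [mul_assoc, h.left_mul_right, mul_zero])
  rw [h4, h.map_mul_left, h.swap.map_left_mul] at h3
  rw [h.map_left_mul, h.map_mul_upper y hz hz'] at h2
  have h5 : x * y * z = x * (e * (y * z)) + x * (f * y * e) * z := by
    rw [h.compl]
    simp only [mul_sub, sub_mul, one_mul, mul_assoc, hz]
    abel
  rw [h5, h.map_add, h2, h3, h.compl] at h1
  simp only [mul_sub, sub_mul, mul_add, add_mul, one_mul, mul_assoc, hz, hD] at h1
  rw [mul_assoc _ e b, mul_assoc _ (e * b) f, ← hzdef]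
  simp only [sub_mul, add_mul, mul_assoc]
  linear_combination (norm := module) -h1

theorem map_mul (h : ScaledJordanDeriv e f k γ D) (x y : A) :
    D (x * y) = D x * y + x * D y := by
  rw [← mul_one (D (x * y)), ← h.left_add_right, mul_add, h.map_mul_mul_left,
    h.swap.map_mul_mul_left, ← mul_add, h.left_add_right, mul_one]

end ScaledJordanDeriv

/-- The Jordan product. -/
def jordan (x y : A) : A := x * y + y * x

theorem jordan_smul_left (m : ℤ) (x y : A) : jordan (m • x) y = m • jordan x y := by
  simp only [jordan, smul_mul_assoc, mul_smul_comm, smul_add]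

theorem jordan_add_left (x y z : A) : jordan (x + y) z = jordan x z + jordan y z := by
  simp only [jordan, add_mul, mul_add]; abel

theorem jordan_sub_left (x y z : A) : jordan (x - y) z = jordan x z - jordan y z := by
  simp only [jordan, sub_mul, mul_sub]; abel

theorem jordan_one (x : A) : jordan x 1 = (2 : ℤ) • x := by
  simp only [jordan, mul_one, one_mul, two_smul]

theorem jordan_comm (x y : A) : jordan x y = jordan y x := add_comm _ _

theorem foldl_jordan_replicate_one_s9 (k : ℕ) (u : A) :
    (List.replicate k (1 : A)).foldl jordan u = (2 : ℤ) ^ k • u := by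
  induction k generalizing u with
  | zero => simp
  | succ k ih => rw [List.replicate_succ, List.foldl_cons, ih, jordan_one, smul_smul, pow_succ]

theorem two_smul_foldl_jordan_set_s9 (k i : ℕ) (hi : i < k) (c u : A) :
    (2 : ℤ) • ((List.replicate k (1 : A)).set i c).foldl jordan u =
      (2 : ℤ) ^ k • jordan u c := by
  induction k generalizing u i with
  | zero => omega
  | succ k ih =>
    rw [List.replicate_succ]
    cases i with
    | zero =>
      rw [List.set_cons_zero, List.foldl_cons, foldl_jordan_replicate_one_s9, smul_smul, pow_succ']
    | succ i =>
      rw [List.set_cons_succ, List.foldl_cons, ih i (by omega), jordan_one, jordan_smul_left,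
        smul_smul, pow_succ]

theorem two_smul_sum_foldl_jordan_set (k : ℕ) (δ : A → A) (u : A) :
    (2 : ℤ) • ∑ i ∈ Finset.range k, ((List.replicate k (1 : A)).set i
      (δ ((List.replicate k (1 : A)).getD i 0))).foldl jordan u =
      ((k : ℤ) * 2 ^ k) • jordan u (δ 1) := by
  rw [Finset.smul_sum, Finset.sum_congr rfl fun i hi => ?_, Finset.sum_const, Finset.card_range,
    mul_smul, natCast_zsmul]
  have hi' := Finset.mem_range.1 hi
  rw [two_smul_foldl_jordan_set_s9 k i hi', List.getD_eq_getElem _ _ (by simpa using hi'),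
    List.getElem_replicate]

theorem jordanProd_cons (t : A) (l : List A) : jordanProd (t :: l) = l.foldl jordan t := rfl

theorem IsMulJordanDeriv.binary {k : ℕ} {δ : A → A} (h : IsMulJordanDeriv (k + 2) δ) (x y : A) :
    (2 : ℤ) • δ ((2 : ℤ) ^ k • jordan x y) =
      (2 : ℤ) ^ (k + 1) • (jordan (δ x) y + jordan x (δ y)) +
        ((k : ℤ) * 2 ^ k) • jordan (jordan x y) (δ 1) := by
  have h1 := h (x :: y :: List.replicate k 1) (by simp)
  rw [Finset.sum_range_succ', Finset.sum_range_succ'] at h1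
  simp only [List.set_cons_succ, List.set_cons_zero, List.getD_cons_succ, List.getD_cons_zero,
    jordanProd_cons, List.foldl_cons, foldl_jordan_replicate_one_s9] at h1
  rw [h1, smul_add, smul_add, two_smul_sum_foldl_jordan_set]
  module

theorem IsMulJordanDeriv.ternary {k : ℕ} {δ : A → A} (h : IsMulJordanDeriv (k + 3) δ)
    (x y z : A) :
    (2 : ℤ) • δ ((2 : ℤ) ^ k • jordan (jordan x y) z) =
      (2 : ℤ) ^ (k + 1) • (jordan (jordan (δ x) y) z + jordan (jordan x (δ y)) z +
        jordan (jordan x y) (δ z)) +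
        ((k : ℤ) * 2 ^ k) • jordan (jordan (jordan x y) z) (δ 1) := by
  have h1 := h (x :: y :: z :: List.replicate k 1) (by simp)
  rw [Finset.sum_range_succ', Finset.sum_range_succ', Finset.sum_range_succ'] at h1
  simp only [List.set_cons_succ, List.set_cons_zero, List.getD_cons_succ, List.getD_cons_zero,
    jordanProd_cons, List.foldl_cons, foldl_jordan_replicate_one_s9] at h1
  rw [h1, smul_add, smul_add, smul_add, two_smul_sum_foldl_jordan_set]
  module

theorem IsMulGenJordanDeriv.binary {k : ℕ} {Δ δ : A → A} (h : IsMulGenJordanDeriv (k + 2) Δ δ)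
    (x y : A) :
    (2 : ℤ) • Δ ((2 : ℤ) ^ k • jordan x y) =
      (2 : ℤ) ^ (k + 1) • (jordan (Δ x) y + jordan x (δ y)) +
        ((k : ℤ) * 2 ^ k) • jordan (jordan x y) (δ 1) := by
  have h1 := h (x :: y :: List.replicate k 1) (by simp)
  rw [Finset.sum_Ico_eq_sum_range, Nat.add_sub_assoc (by norm_num), Finset.sum_range_succ'] at h1
  simp only [add_comm 1, List.set_cons_succ, List.set_cons_zero, List.getD_cons_succ,
    List.getD_cons_zero, jordanProd_cons, List.foldl_cons, foldl_jordan_replicate_one_s9] at h1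
  rw [h1, smul_add, smul_add, two_smul_sum_foldl_jordan_set]
  module

theorem zsmul_eq_zero_or (hprime : ∀ u v : A, (∀ a : A, u * a * v = 0) → u = 0 ∨ v = 0)
    {m : ℤ} {t : A} (h : m • t = 0) : m • (1 : A) = 0 ∨ t = 0 :=
  hprime _ _ fun a => by
    rw [smul_mul_assoc, one_mul, smul_mul_assoc, ← mul_smul_comm, h, mul_zero]

theorem central_of_jordan_right_comm
    (hprime : ∀ u v : A, (∀ a : A, u * a * v = 0) → u = 0 ∨ v = 0) {c : A}
    (h : ∀ x y, jordan (jordan x c) y = jordan (jordan x y) c) (a : A) : c * a = a * c := by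
  have h1 : ∀ x y, x * (c * y - y * c) = (c * y - y * c) * x := fun x y => by
    have := h x y
    simp only [jordan] at this
    simp only [mul_sub, sub_mul, mul_add, add_mul, mul_assoc] at this ⊢
    linear_combination (norm := module) this
  have h3 : ∀ z, (c * a - a * c) * z * (c * a - a * c) = 0 := fun z => by
    have e1 := h1 a (a * c)
    have e2 : c * (a * c) - a * c * c = (c * a - a * c) * c := by
      rw [sub_mul, mul_assoc, mul_assoc]
    rw [e2, ← mul_assoc, h1 a a, mul_assoc, mul_assoc, ← sub_eq_zero, ← mul_sub,
      ← neg_sub (c * a), mul_neg, neg_eq_zero] at e1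
    rw [mul_assoc, h1 z a, ← mul_assoc, e1, zero_mul]
  exact sub_eq_zero.1 (or_self_iff.1 (hprime _ _ h3))

theorem IsMulJordanDeriv.map_one_central {k : ℕ} {δ : A → A} (h : IsMulJordanDeriv (k + 2) δ)
    (h2 : ∀ t : A, (2 : ℤ) • t = 0 → t = 0)
    (hprime : ∀ u v : A, (∀ a : A, u * a * v = 0) → u = 0 ∨ v = 0) (h01 : (1 : A) ≠ 0) (a : A) :
    δ 1 * a = a * δ 1 := by
  have hM : ∀ (m : ℕ) (t : A), (2 : ℤ) ^ m • t = 0 → t = 0 := two_pow_smul_eq_zero h2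
  have two_pow_smul : ∀ x, (2 : ℤ) • δ ((2 : ℤ) ^ (k + 1) • x) =
      (2 : ℤ) ^ (k + 2) • δ x + ((k + 1 : ℤ) * 2 ^ (k + 1)) • jordan x (δ 1) := fun x => by
    have := h.binary x 1
    rw [jordan_one, jordan_one, smul_smul, ← pow_succ, jordan_smul_left] at this
    rw [this]
    module
  by_cases hk : (k + 1 : ℤ) • (1 : A) = 0
  · obtain _ | k := k
    · simp [h01] at hk
    have hk' : (k + 1 : ℤ) • (1 : A) ≠ 0 := fun h0 => h01 (by
      push_cast at hk
      linear_combination (norm := module) hk - h0)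
    have key : ∀ x y z, jordan (jordan (jordan x y) (δ 1)) z =
        jordan (jordan (jordan x y) z) (δ 1) := fun x y z => by
      refine sub_eq_zero.1 ((zsmul_eq_zero_or hprime (m := (k + 1 : ℤ)) ?_).resolve_left hk')
      have e1 := h.binary ((2 : ℤ) ^ (k + 1) • jordan x y) z
      have e2 := two_pow_smul ((2 : ℤ) ^ k • jordan (jordan x y) z)
      have e3 := h.ternary x y z
      have e4 := congrArg (fun t => jordan t z) (h.binary x y)
      simp only [jordan_smul_left, jordan_add_left] at e1 e2 e3 e4
      rw [smul_smul, ← pow_add, show k + 1 + 1 + k = k + 1 + (k + 1) by ring] at e2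
      rw [smul_smul, ← pow_add] at e1
      push_cast at e1 e2 e4
      refine hM (2 * k + 3) _ ?_
      linear_combination (norm := module) (-2 : ℤ) • e1 + (2 : ℤ) • e2 +
        (2 : ℤ) ^ (k + 3) • e3 - (2 : ℤ) ^ (k + 2) • e4
    refine central_of_jordan_right_comm hprime (fun x y => sub_eq_zero.1 (h2 _ ?_)) a
    have := key x 1 y
    simp only [jordan_one, jordan_smul_left] at this
    rw [smul_sub, this, sub_self]
  · refine central_of_jordan_right_comm hprime (fun x y => sub_eq_zero.1
      ((zsmul_eq_zero_or hprime (m := (k + 1 : ℤ)) ?_).resolve_left hk)) a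
    have e1 := h.binary ((2 : ℤ) ^ (k + 1) • x) y
    have e2 := two_pow_smul ((2 : ℤ) ^ k • jordan x y)
    have e3 := h.binary x y
    have e4 := congrArg (fun t => jordan t y) (two_pow_smul x)
    simp only [jordan_smul_left, jordan_add_left] at e1 e2 e3 e4
    rw [smul_comm ((2 : ℤ) ^ k)] at e1
    refine hM (2 * k + 2) _ ?_
    linear_combination (norm := module) (-2 : ℤ) • e1 + (2 : ℤ) • e2 +
      (2 : ℤ) ^ (k + 2) • e3 - (2 : ℤ) ^ (k + 1) • e4

/-- The difference between a generalized Jordan `n`-derivation and its associated Jordan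
`n`-derivation is multiplication by a central element. -/
theorem IsMulGenJordanDeriv.exists_central {k : ℕ} {Δ δ : A → A}
    (hΔ : IsMulGenJordanDeriv (k + 2) Δ δ) (hδ : IsMulJordanDeriv (k + 2) δ)
    (h2 : ∀ t : A, (2 : ℤ) • t = 0 → t = 0)
    (hprime : ∀ u v : A, (∀ a : A, u * a * v = 0) → u = 0 ∨ v = 0) (h01 : (1 : A) ≠ 0) :
    ∃ g : A, (∀ a, g * a = a * g) ∧ ∀ x, Δ x = g * x + δ x := by
  have hM : ∀ (m : ℕ) (t : A), (2 : ℤ) ^ m • t = 0 → t = 0 := two_pow_smul_eq_zero h2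
  have hc := hδ.map_one_central h2 hprime h01
  have hsub : ∀ x, (2 : ℤ) • (Δ x - δ x) = jordan x (Δ 1 - δ 1) := fun x => by
    have e1 := hΔ.binary x 1
    have e2 := hΔ.binary 1 x
    rw [jordan_comm 1 x, e1, jordan_comm 1 (δ x), jordan_one, jordan_one] at e2
    refine sub_eq_zero.1 (hM (k + 1) _ ?_)
    simp only [jordan, mul_sub, sub_mul, hc x, mul_one, one_mul] at e2 ⊢
    linear_combination (norm := module) e2
  have hbin : ∀ x y, Δ ((2 : ℤ) ^ k • jordan x y) - δ ((2 : ℤ) ^ k • jordan x y) =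
      (2 : ℤ) ^ k • (jordan (Δ x) y - jordan (δ x) y) := fun x y => by
    have e1 := hΔ.binary x y
    have e2 := hδ.binary x y
    refine sub_eq_zero.1 (h2 _ ?_)
    linear_combination (norm := module) e1 - e2
  have hg : ∀ a, (Δ 1 - δ 1) * a = a * (Δ 1 - δ 1) := by
    refine central_of_jordan_right_comm hprime fun x y => sub_eq_zero.1 (hM k _ ?_)
    have e1 := congrArg (fun t => (2 : ℤ) • t) (hbin x y)
    have e2 := congrArg (fun t => jordan t y) (hsub x)
    simp only [hsub, jordan_smul_left] at e1
    simp only [jordan_smul_left, jordan_sub_left] at e2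
    linear_combination (norm := module) (-1 : ℤ) • e1 - (2 : ℤ) ^ k • e2
  refine ⟨Δ 1 - δ 1, hg, fun x => ?_⟩
  have := hsub x
  rw [jordan, ← hg, ← two_smul ℤ] at this
  refine sub_eq_zero.1 (h2 _ ?_)
  linear_combination (norm := module) this

theorem IsMulJordanDeriv.leibniz_sub {k : ℕ} {δ : A → A} (h : IsMulJordanDeriv (k + 2) δ)
    (h2 : ∀ t : A, (2 : ℤ) • t = 0 → t = 0) (hc : ∀ a, δ 1 * a = a * δ 1) (s : A) {D : A → A}
    (hD : ∀ x, D x = δ x - δ 1 * x - (s * x - x * s)) (x y : A) :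
    D ((2 : ℤ) ^ k • (x * y + y * x)) =
      (2 : ℤ) ^ k • (D x * y + y * D x + (x * D y + D y * x) +
        ((k + 1 : ℤ) • δ 1) * (x * y + y * x)) := by
  have e1 := h.binary x y
  have hc' : ∀ a b, a * (δ 1 * b) = δ 1 * (a * b) := fun a b => by
    rw [← mul_assoc, ← hc, mul_assoc]
  refine sub_eq_zero.1 (h2 _ ?_)
  simp only [hD, jordan, mul_sub, sub_mul, mul_add, add_mul, mul_smul_comm, smul_mul_assoc,
    mul_assoc, ← hc, hc', smul_add] at e1 ⊢
  linear_combination (norm := module) e1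

theorem IsMulJordanDeriv.exists_derivation {k : ℕ} {δ : A → A} (h : IsMulJordanDeriv (k + 2) δ)
    (h2 : ∀ t : A, (2 : ℤ) • t = 0 → t = 0)
    (hprime : ∀ u v : A, (∀ a : A, u * a * v = 0) → u = 0 ∨ v = 0)
    {e : A} (he : e * e = e) (he0 : e ≠ 0) (he1 : e ≠ 1) :
    ∃ d : A → A, (∀ x y, d (x + y) = d x + d y) ∧ (∀ x y, d (x * y) = d x * y + x * d y) ∧
      (∀ a, δ 1 * a = a * δ 1) ∧ ∀ x, δ x = δ 1 * x + d x := by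
  have h01 : (1 : A) ≠ 0 := fun h => he0 (by rw [← mul_one e, h, mul_zero])
  have hc := h.map_one_central h2 hprime h01
  have hM := two_pow_smul_eq_zero h2 k
  have map_idem : ∀ s : A, ∀ p : A, p * p = p →
      ∀ D : A → A, (∀ x, D x = δ x - δ 1 * x - (s * x - x * s)) → p * D p + D p * p = D p :=
    fun s p hp D hD => by
      have hD1 : D 1 = 0 := by rw [hD, mul_one, mul_one, one_mul, sub_self, sub_self, sub_self]
      have e1 := h.leibniz_sub h2 hc s hD p p
      have e2 := h.leibniz_sub h2 hc s hD p 1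
      rw [hp] at e1
      rw [mul_one, one_mul, e1, hD1] at e2
      refine sub_eq_zero.1 (h2 _ (hM _ ?_))
      simp only [mul_one, one_mul, mul_zero, zero_mul] at e2
      linear_combination (norm := module) e2
  set d₀ : A → A := fun x => δ x - δ 1 * x - (0 * x - x * 0) with hd₀
  have ha := map_idem 0 e he d₀ fun _ => rfl
  set s := (1 - e) * d₀ e * e - e * d₀ e * (1 - e) with hs
  set D : A → A := fun x => δ x - δ 1 * x - (s * x - x * s) with hDdef
  have hD : ∀ x, D x = δ x - δ 1 * x - (s * x - x * s) := fun _ => rfl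
  have hL := h.leibniz_sub h2 hc s hD
  have hDe : D e = 0 := by
    have e1 : D e = d₀ e - (s * e - e * s) := by simp [D, d₀]
    rw [e1, hs]
    simp only [mul_sub, sub_mul, one_mul, mul_one, mul_assoc, half_mul_idem ha,
      idem_mul_cancel he]
    abel
  have hf : (1 - e) * (1 - e) = 1 - e := by
    simp only [mul_sub, sub_mul, one_mul, mul_one, he]; abel
  have hDf : D (1 - e) = 0 := by
    have e1 := hL e (1 - e)
    have e2 := map_idem s (1 - e) hf D hD
    have hef : e * (1 - e) = 0 := by rw [mul_sub, he, mul_one, sub_self]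
    have hfe : (1 - e) * e = 0 := by rw [sub_mul, he, one_mul, sub_self]
    have hD0 : D 0 = 0 := by simpa using hL 0 0
    rw [hef, hfe, hDe, add_zero, smul_zero, hD0] at e1
    have e3 := hM _ e1.symm
    simp only [mul_zero, zero_mul, sub_mul, mul_sub, one_mul, mul_one] at e2 e3
    linear_combination (norm := module) e2 + e3
  have key : ScaledJordanDeriv e (1 - e) k ((k + 1 : ℤ) • δ 1) D :=
    { two_torsion := h2
      prime := hprime
      idem := he
      compl := rfl
      left_ne := he0
      right_ne := fun h0 => he1 (sub_eq_zero.1 h0).symm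
      central := fun a => by rw [smul_mul_assoc, mul_smul_comm, hc]
      map_left := hDe
      map_right := hDf
      map_one := by rw [hD, mul_one, mul_one, one_mul, sub_self, sub_self, sub_self]
      leibniz := hL }
  refine ⟨fun x => D x + (s * x - x * s), fun x y => ?_, fun x y => ?_, hc, fun x => ?_⟩
  · simp only [key.map_add, mul_add, add_mul]; abel
  · simp only [key.map_mul, mul_add, add_mul, mul_sub, sub_mul, mul_assoc]; abel
  · simp only [hD]; abel

end

/-- Every multiplicative generalized Jordan `n`-derivation of a 2-torsion-free unital
prime ring with a nontrivial idempotent has the form `Δ(t) = μt + δ(t)` with `μ`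
central and `δ` a derivation. -/
theorem stmt_9 {A : Type*} [Ring A] (n : ℕ) (hn : 2 ≤ n)
    (h2 : ∀ t : A, 2 * t = 0 → t = 0)
    (hprime : ∀ u v : A, (∀ a : A, u * a * v = 0) → u = 0 ∨ v = 0)
    (e : A) (hidem : e * e = e) (he0 : e ≠ 0) (he1 : e ≠ 1)
    (Δ δ₀ : A → A) (hδ₀ : IsMulJordanDeriv n δ₀) (hΔ : IsMulGenJordanDeriv n Δ δ₀) :
    ∃ μ : A, ∃ δ : A → A,
      (∀ a : A, μ * a = a * μ) ∧
      (∀ x y : A, δ (x + y) = δ x + δ y) ∧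
      (∀ x y : A, δ (x * y) = δ x * y + x * δ y) ∧
      ∀ t : A, Δ t = μ * t + δ t := by
  obtain ⟨k, rfl⟩ := Nat.exists_eq_add_of_le' hn
  have h2' : ∀ t : A, (2 : ℤ) • t = 0 → t = 0 := fun t ht => h2 t (by
    rwa [two_mul, ← two_smul ℤ])
  have h01 : (1 : A) ≠ 0 := fun h => he0 (by rw [← mul_one e, h, mul_zero])
  obtain ⟨g, hg, hΔg⟩ := hΔ.exists_central hδ₀ h2' hprime h01
  obtain ⟨d, hadd, hmul, hc, hd⟩ := hδ₀.exists_derivation h2' hprime hidem he0 he1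
  refine ⟨g + δ₀ 1, d, fun a => ?_, hadd, hmul, fun t => ?_⟩
  · rw [add_mul, mul_add, hg, hc]
  · rw [hΔg, hd t, add_mul, add_assoc]
end

section
/- Let n ≥ 2 be an integer and let A be a unital ring. If Φ : A → A is a multiplicative Jordan n-centralizer, then qₙ(Φ(t₁), t₂, …, tₙ) = qₙ(t₁, Φ(t₂), t₃, …, tₙ) for all t₁, t₂, …, tₙ ∈ A. -/
/-- A map `Φ` (not assumed additive) is a multiplicative Jordan `n`-centralizer if
`Φ(qₙ(t₁,t₂,…,tₙ)) = qₙ(Φ(t₁),t₂,…,tₙ)` for all `t₁,…,tₙ`. -/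
def IsMulJordanCentralizer {A : Type*} [Ring A] (n : ℕ) (Φ : A → A) : Prop :=
  ∀ l : List A, l.length = n →
    Φ (jordanProd l) = jordanProd (l.set 0 (Φ (l.getD 0 0)))

theorem jordanProd_swap {A : Type*} [Ring A] (a b : A) (l : List A) :
    jordanProd (a :: b :: l) = jordanProd (b :: a :: l) := by
  simp only [jordanProd, List.foldl_cons, add_comm]

/-- If `Φ` is a multiplicative Jordan `n`-centralizer on a unital ring, then
`qₙ(Φ(t₁),t₂,…,tₙ) = qₙ(t₁,Φ(t₂),t₃,…,tₙ)` for all `t₁,…,tₙ`. -/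
theorem stmt_14 {A : Type*} [Ring A] (n : ℕ) (hn : 2 ≤ n)
    (Φ : A → A) (hΦ : IsMulJordanCentralizer n Φ) :
    ∀ l : List A, l.length = n →
      jordanProd (l.set 0 (Φ (l.getD 0 0))) = jordanProd (l.set 1 (Φ (l.getD 1 0))) := by
  intro l hl
  match l, hl with
  | [], hl | [_], hl => simp at hl; omega
  | a :: b :: l, hl =>
    rw [← hΦ _ hl, jordanProd_swap, hΦ (b :: a :: l) hl]
    exact jordanProd_swap _ _ _
end
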